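/- arXiv:2510.01294 — 11 statements merged into one kernel-verified Lean document; each statement's English description precedes it below -/
import Mathlib

section
/- Let G be a finite simple connected graph and let x be a vertex of G that is not a cut vertex. Then gp_t(G) - 1 ≤ gp_t(G - x). -/
open SimpleGraph

variable {V : Type*}

/-- Two vertices `x` and `y` are `Z`-positionable in `G` if no shortest `x,y`-path
contains a vertex of `Z` as an internal vertex. -/
def ZPositionable (G : SimpleGraph V) (Z : Set V) (x y : V) : Prop :=
  ∀ p : G.Walk x y, p.IsPath → p.length = G.dist x y →
    ∀ z ∈ Z, z ∈ p.support → z = x ∨ z = y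

/-- `Z` is a total general position set of `G`: every pair of vertices of `G`
is `Z`-positionable. -/
def IsTotalGPSet (G : SimpleGraph V) (Z : Set V) : Prop :=
  ∀ x y : V, ZPositionable G Z x y

/-- `Z` is an outer general position set of `G`: every pair of vertices of `Z`
is `Z`-positionable, and every `u ∈ Z`, `v ∉ Z` are `Z`-positionable. -/
def IsOuterGPSet (G : SimpleGraph V) (Z : Set V) : Prop :=
  ∀ x ∈ Z, ∀ y : V, ZPositionable G Z x y

/-- `Z` is a dual general position set of `G`: every pair of vertices of `Z`
is `Z`-positionable, and every pair of vertices outside `Z` is `Z`-positionable. -/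
def IsDualGPSet (G : SimpleGraph V) (Z : Set V) : Prop :=
  (∀ x ∈ Z, ∀ y ∈ Z, ZPositionable G Z x y) ∧
  (∀ x ∉ Z, ∀ y ∉ Z, ZPositionable G Z x y)

/-- The total general position number of `G`. -/
noncomputable def gpt (G : SimpleGraph V) : ℕ :=
  sSup {n | ∃ Z : Set V, IsTotalGPSet G Z ∧ Z.ncard = n}

/-- The outer general position number of `G`. -/
noncomputable def gpo (G : SimpleGraph V) : ℕ :=
  sSup {n | ∃ Z : Set V, IsOuterGPSet G Z ∧ Z.ncard = n}

/-- The dual general position number of `G`. -/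
noncomputable def gpd (G : SimpleGraph V) : ℕ :=
  sSup {n | ∃ Z : Set V, IsDualGPSet G Z ∧ Z.ncard = n}

/-- A vertex `x` is simplicial in `G` if its neighborhood induces a complete subgraph. -/
def IsSimplicial (G : SimpleGraph V) (x : V) : Prop :=
  ∀ u v : V, G.Adj x u → G.Adj x v → u ≠ v → G.Adj u v

/-- `u` is maximally distant from `v` in `G`. -/
def MaxDistantFrom (G : SimpleGraph V) (u v : V) : Prop :=
  ∀ w : V, G.Adj u w → G.dist w v ≤ G.dist u v

/-- `u` and `v` are mutually maximally distant (MMD) in `G`. -/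
def MutuallyMaximallyDistant (G : SimpleGraph V) (u v : V) : Prop :=
  MaxDistantFrom G u v ∧ MaxDistantFrom G v u

theorem IsTotalGPSet.isSimplicial {G : SimpleGraph V} {Z : Set V} (hZ : IsTotalGPSet G Z)
    {z : V} (hz : z ∈ Z) : IsSimplicial G z := by
  intro u v hu hv huv
  by_contra hadj
  let p : G.Walk u v := Walk.cons hu.symm (Walk.cons hv Walk.nil)
  have hdist : 1 < G.dist u v := p.reachable.one_lt_dist_of_ne_of_not_adj huv hadj
  have hle : G.dist u v ≤ 2 := dist_le p
  have hp : p.IsPath := by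
    simp [p, Walk.cons_isPath_iff, hu.ne', hv.ne, huv]
  have hlen : p.length = G.dist u v := by
    change 2 = _
    omega
  rcases hZ u v p hp hlen z hz (by simp [p]) with h | h
  · exact hu.ne h
  · exact hv.ne h

theorem IsSimplicial.eq_or_eq_of_mem_support {G : SimpleGraph V} {z u v : V}
    (hz : IsSimplicial G z) (p : G.Walk u v) (hp : p.length = G.dist u v)
    (hmem : z ∈ p.support) : z = u ∨ z = v := by
  obtain ⟨q, r, rfl⟩ := Walk.mem_support_iff_exists_append.mp hmem
  rw [Walk.length_append, ← Walk.length_reverse q] at hp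
  generalize q.reverse = q' at hp
  cases q' with
  | nil => exact Or.inl rfl
  | cons hu q' =>
    rename_i a
    cases r with
    | nil => exact Or.inr rfl
    | cons hv r =>
      rename_i b
      exfalso
      simp only [Walk.length_cons] at hp
      by_cases hab : a = b
      · subst hab
        have := dist_le (q'.reverse.append r)
        simp only [Walk.length_append, Walk.length_reverse] at this
        omega
      · have := dist_le (q'.reverse.append (Walk.cons (hz a b hu hv hab) r))
        simp only [Walk.length_append, Walk.length_reverse, Walk.length_cons] at this
        omega

theorem isTotalGPSet_iff_forall_isSimplicial {G : SimpleGraph V} {Z : Set V} :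
    IsTotalGPSet G Z ↔ ∀ z ∈ Z, IsSimplicial G z :=
  ⟨fun hZ _ hz => hZ.isSimplicial hz,
    fun hZ _ _ p _ hp z hz hmem => (hZ z hz).eq_or_eq_of_mem_support p hp hmem⟩

theorem IsSimplicial.induce {G : SimpleGraph V} {s : Set V} {z : s}
    (hz : IsSimplicial G z) : IsSimplicial (G.induce s) z :=
  fun u v hu hv huv => hz u v hu hv (Subtype.coe_injective.ne huv)

theorem IsTotalGPSet.induce {G : SimpleGraph V} {Z : Set V} (hZ : IsTotalGPSet G Z)
    (s : Set V) : IsTotalGPSet (G.induce s) (Subtype.val ⁻¹' Z) :=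
  isTotalGPSet_iff_forall_isSimplicial.mpr fun _ hz => (hZ.isSimplicial hz).induce

theorem bddAbove_ncard_isTotalGPSet [Finite V] (G : SimpleGraph V) :
    BddAbove {n | ∃ Z : Set V, IsTotalGPSet G Z ∧ Z.ncard = n} := by
  refine ⟨Nat.card V, ?_⟩
  rintro _ ⟨Z, -, rfl⟩
  exact Set.ncard_le_card Z

theorem IsTotalGPSet.ncard_le_gpt [Finite V] {G : SimpleGraph V} {Z : Set V}
    (hZ : IsTotalGPSet G Z) : Z.ncard ≤ gpt G :=
  le_csSup (bddAbove_ncard_isTotalGPSet G) ⟨Z, hZ, rfl⟩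

theorem exists_isTotalGPSet_ncard_eq_gpt [Finite V] (G : SimpleGraph V) :
    ∃ Z : Set V, IsTotalGPSet G Z ∧ Z.ncard = gpt G :=
  Nat.sSup_mem (s := {n | ∃ Z : Set V, IsTotalGPSet G Z ∧ Z.ncard = n})
    ⟨0, ∅, fun _ _ _ _ _ _ hz => hz.elim, Set.ncard_empty V⟩ (bddAbove_ncard_isTotalGPSet G)

/-- If `x` is not a cut vertex of the finite connected graph `G`,
then `gp_t(G) - 1 ≤ gp_t(G - x)`. -/
theorem gpt_vertex_removal_lower [Fintype V] (G : SimpleGraph V) (hG : G.Connected)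
    (x : V) (hx : (G.induce {y : V | y ≠ x}).Connected) :
    gpt G - 1 ≤ gpt (G.induce {y : V | y ≠ x}) := by
  obtain ⟨Z, hZ, hcard⟩ := exists_isTotalGPSet_ncard_eq_gpt G
  refine le_trans ?_ (hZ.induce {y : V | y ≠ x}).ncard_le_gpt
  have himage : Subtype.val '' (Subtype.val ⁻¹' Z : Set {y : V | y ≠ x}) = Z \ {x} := by
    rw [Subtype.image_preimage_coe, Set.inter_comm]
    rfl
  rw [← Set.ncard_image_of_injective _ Subtype.val_injective, himage, ← hcard]
  exact Set.pred_ncard_le_ncard_sdiff_singleton Z x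
end

section
/- Let G be a finite simple connected graph on at least two vertices and let x be a simplicial vertex of G. Then gp_t(G - x) ≤ gp_t(G) + deg_G(x) - 1. -/
open SimpleGraph

variable {V : Type*}

theorem isTotalGPSet_of_forall_isSimplicial {G : SimpleGraph V} {Z : Set V}
    (hZ : ∀ z ∈ Z, IsSimplicial G z) : IsTotalGPSet G Z := by
  classical
  intro a b p _ hp z hz hzp
  by_contra! hne
  have h_len := congrArg Walk.length (p.take_spec hzp)
  rw [Walk.length_append, ← Walk.length_reverse] at h_len
  generalize (p.takeUntil z hzp).reverse = q at h_len
  generalize p.dropUntil z hzp = r at h_len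
  cases q with
  | nil => exact hne.1 rfl
  | @cons _ u _ hu q =>
    cases r with
    | nil => exact hne.2 rfl
    | @cons _ v _ hv r =>
      simp only [Walk.length_cons] at h_len
      by_cases huv : u = v
      · subst huv
        have := dist_le (q.reverse.append r)
        simp only [Walk.length_append, Walk.length_reverse] at this
        omega
      · have := dist_le (q.reverse.append (.cons (hZ z hz u v hu hv huv) r))
        simp only [Walk.length_append, Walk.length_reverse, Walk.length_cons] at this
        omega

/-- If `x` is a simplicial vertex of the finite connected graph `G`
on at least two vertices, then `gp_t(G - x) ≤ gp_t(G) + deg_G(x) - 1`. -/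
theorem gpt_vertex_removal_simplicial [Fintype V] [Nontrivial V]
    (G : SimpleGraph V) [DecidableRel G.Adj] (hG : G.Connected)
    (x : V) (hx : IsSimplicial G x) :
    gpt (G.induce {y : V | y ≠ x}) ≤ gpt G + G.degree x - 1 := by
  refine csSup_le' ?_
  rintro n ⟨Z, hZ, rfl⟩
  set A : Set V := Subtype.val '' Z with hA
  have hAx : x ∉ A := by
    rintro ⟨z, -, hz⟩
    exact z.2 hz
  have hB : IsTotalGPSet G (insert x (A \ G.neighborSet x)) := by
    refine isTotalGPSet_of_forall_isSimplicial fun z hz => ?_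
    rcases hz with rfl | ⟨⟨z, hzZ, rfl⟩, hzx⟩
    · exact hx
    · intro u v hu hv huv
      have hux : u ≠ x := by
        rintro rfl
        exact hzx hu.symm
      have hvx : v ≠ x := by
        rintro rfl
        exact hzx hv.symm
      exact hZ.isSimplicial hzZ ⟨u, hux⟩ ⟨v, hvx⟩ hu hv fun h => huv (congrArg Subtype.val h)
  have h_le := hB.ncard_le_gpt
  rw [Set.ncard_insert_of_notMem fun h => hAx h.1] at h_le
  have h_card : A.ncard = Z.ncard := Set.ncard_image_of_injective _ Subtype.val_injective
  have h_deg : (G.neighborSet x).ncard = G.degree x := by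
    rw [Set.ncard_eq_toFinset_card', ← SimpleGraph.card_neighborFinset_eq_degree]
    rfl
  have h_sdiff := Set.ncard_le_ncard_sdiff_add_ncard A (G.neighborSet x)
  omega
end

section
/- Let G be a finite simple connected graph and let x be a vertex of G that is not a cut vertex and lies in some gp_o-set of G (i.e., in some outer general position set of maximum cardinality). Then gp_o(G) - 1 ≤ gp_o(G - x). -/
open SimpleGraph

variable {V : Type*}

theorem IsOuterGPSet.ncard_le_gpo [Finite V] {G : SimpleGraph V} {Z : Set V}
    (hZ : IsOuterGPSet G Z) : Z.ncard ≤ gpo G := by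
  refine le_csSup ⟨Nat.card V, ?_⟩ ⟨Z, hZ, rfl⟩
  rintro n ⟨Y, -, rfl⟩
  exact Set.ncard_le_card Y

theorem IsOuterGPSet.dist_induce_ne {G : SimpleGraph V} (hG : G.Connected) {X : Set V}
    (hX : IsOuterGPSet G X) {x : V} (hxX : x ∈ X) (u v : {y : V | y ≠ x}) (hu : u.1 ∈ X) :
    (G.induce {y : V | y ≠ x}).dist u v = G.dist u v := by
  obtain ⟨q, hqp, hql⟩ := hG.exists_path_of_dist u.1 v.1
  have hq : ∀ y ∈ q.support, y ∈ {y : V | y ≠ x} := by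
    rintro y hy rfl
    rcases hX u hu v q hqp hql y hxX hy with h | h
    · exact u.2 h.symm
    · exact v.2 h.symm
  have hlen : (q.induce _ hq).length = q.length := by
    rw [← Walk.length_map (Embedding.induce _).toHom (q.induce _ hq), Walk.map_induce]
    rfl
  obtain ⟨p, hp⟩ := (q.induce _ hq).reachable.exists_walk_length_eq_dist
  apply le_antisymm
  · rw [← hql, ← hlen]
    exact dist_le _
  · rw [← hp, ← Walk.length_map (Embedding.induce _).toHom p]
    exact dist_le _

theorem IsOuterGPSet.induce_ne {G : SimpleGraph V} (hG : G.Connected) {X : Set V}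
    (hX : IsOuterGPSet G X) {x : V} (hxX : x ∈ X) :
    IsOuterGPSet (G.induce {y : V | y ≠ x}) (Subtype.val ⁻¹' X) := by
  intro u hu v p hp hpl z hz hzp
  have h := hX u hu v (p.map (Embedding.induce _).toHom)
    (hp.map Subtype.val_injective)
    ((Walk.length_map _ p).trans (hpl.trans (hX.dist_induce_ne hG hxX u v hu))) z hz
    ((Walk.support_map _ p).symm ▸ List.mem_map_of_mem hzp)
  exact h.imp Subtype.ext Subtype.ext

/-- If `x` is not a cut vertex of the finite connected graph `G`
and `x` lies in some gp_o-set of `G`, then `gp_o(G) - 1 ≤ gp_o(G - x)`. -/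
theorem gpo_vertex_removal_lower [Fintype V] (G : SimpleGraph V) (hG : G.Connected)
    (x : V) (hx : (G.induce {y : V | y ≠ x}).Connected)
    (X : Set V) (hX : IsOuterGPSet G X) (hXcard : X.ncard = gpo G) (hxX : x ∈ X) :
    gpo G - 1 ≤ gpo (G.induce {y : V | y ≠ x}) := by
  have hcard : (Subtype.val ⁻¹' X : Set {y : V | y ≠ x}).ncard = X.ncard - 1 := by
    rw [← Set.ncard_sdiff_singleton_of_mem hxX,
      ← Set.ncard_image_of_injective _ Subtype.val_injective, Subtype.image_preimage_coe,
      Set.inter_comm]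
    rfl
  rw [← hXcard, ← hcard]
  exact (hX.induce_ne hG hxX).ncard_le_gpo
end

section
/- Let G be a finite simple connected graph, let x be a vertex of G that is not a cut vertex, and let u, v be two vertices distinct from x and from each other such that u and v are mutually maximally distant in G, u and x are mutually maximally distant in G, and v and x are mutually maximally distant in G. Then u and v are mutually maximally distant in G - x. -/
open SimpleGraph

variable {V : Type*}

/-- If `x` is maximally distant from `v`, then deleting `x` does not increase distances to `v`. -/
theorem MaxDistantFrom.dist_induce_le {G : SimpleGraph V} (hG : G.Connected) {x v : V}
    (h : MaxDistantFrom G x v) (hvx : v ≠ x) (w : V) (hwx : w ≠ x) :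
    (G.induce {y : V | y ≠ x}).Reachable ⟨w, hwx⟩ ⟨v, hvx⟩ ∧
      (G.induce {y : V | y ≠ x}).dist ⟨w, hwx⟩ ⟨v, hvx⟩ ≤ G.dist w v := by
  induction hn : G.dist w v generalizing w with
  | zero =>
    obtain rfl := hG.dist_eq_zero_iff.mp hn
    simp
  | succ n ih =>
    obtain ⟨p, hp⟩ := hG.exists_walk_length_eq_dist w v
    cases p with
    | nil => simp at hn
    | @cons _ w' _ hadj q =>
      rw [Walk.length_cons] at hp
      have hq := dist_le q
      have htri := hG.dist_triangle (u := w) (v := w') (w := v)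
      rw [dist_eq_one_iff_adj.mpr hadj] at htri
      have hw'x : w' ≠ x := by
        rintro rfl
        have := h w hadj.symm
        omega
      obtain ⟨⟨r⟩, hle⟩ := ih w' hw'x (by omega)
      have hadj' : (G.induce {y : V | y ≠ x}).Adj ⟨w, hwx⟩ ⟨w', hw'x⟩ := hadj
      obtain ⟨s, hs⟩ := r.reachable.exists_walk_length_eq_dist
      have hcons := dist_le (Walk.cons hadj' s)
      rw [Walk.length_cons] at hcons
      exact ⟨⟨Walk.cons hadj' r⟩, by omega⟩

/-- Distances in a connected induced subgraph are at least those in the ambient graph. -/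
theorem dist_le_dist_induce {G : SimpleGraph V} {s : Set V} (hs : (G.induce s).Connected)
    (a b : s) : G.dist a b ≤ (G.induce s).dist a b := by
  obtain ⟨p, hp⟩ := hs.exists_walk_length_eq_dist a b
  rw [← hp, ← Walk.length_map (Embedding.induce s).toHom p]
  exact dist_le _

/-- Maximal distance of `u` from `v` survives deleting a vertex maximally distant from `v`. -/
theorem MaxDistantFrom.induce {G : SimpleGraph V} (hG : G.Connected) {x u v : V}
    (hx : (G.induce {y : V | y ≠ x}).Connected) (hux : u ≠ x) (hvx : v ≠ x)
    (huv : MaxDistantFrom G u v) (hxv : MaxDistantFrom G x v) :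
    MaxDistantFrom (G.induce {y : V | y ≠ x}) ⟨u, hux⟩ ⟨v, hvx⟩ := by
  rintro ⟨w, hwx⟩ hadj
  calc (G.induce {y : V | y ≠ x}).dist ⟨w, hwx⟩ ⟨v, hvx⟩
      ≤ G.dist w v := (hxv.dist_induce_le hG hvx w hwx).2
    _ ≤ G.dist u v := huv w hadj
    _ ≤ _ := dist_le_dist_induce hx ⟨u, hux⟩ ⟨v, hvx⟩

/-- If `x` is not a cut vertex of the finite connected graph `G`
and `u`, `v` are vertices distinct from `x` and from each other such that the
pairs `(u,v)`, `(u,x)`, `(v,x)` are all mutually maximally distant in `G`, then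
`u` and `v` are mutually maximally distant in `G - x`. -/
theorem mmd_vertex_removal [Fintype V] (G : SimpleGraph V) (hG : G.Connected)
    (x : V) (hx : (G.induce {y : V | y ≠ x}).Connected)
    (u v : V) (hux : u ≠ x) (hvx : v ≠ x) (huv : u ≠ v)
    (h1 : MutuallyMaximallyDistant G u v)
    (h2 : MutuallyMaximallyDistant G u x)
    (h3 : MutuallyMaximallyDistant G v x) :
    MutuallyMaximallyDistant (G.induce {y : V | y ≠ x}) ⟨u, hux⟩ ⟨v, hvx⟩ := by
  exact ⟨h1.1.induce hG hx hux hvx h3.2, h1.2.induce hG hx hvx hux h2.2⟩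
end

section
/- Let G be a finite simple connected graph, let X be a dual general position set of G, and let x ∈ X be a vertex that is not a cut vertex of G. Then X∖{x} is a dual general position set of G - x. -/
open SimpleGraph

variable {V : Type*}

/-- If some shortest `u,v`-path in `G` stays inside `s`, then positionability of `u`
and `v` passes to the subgraph induced by `s`. -/
theorem ZPositionable.induce {G : SimpleGraph V} {Z s : Set V} {u v : s}
    (h : ZPositionable G Z u v) (q : G.Walk (u : V) v) (hq : q.length = G.dist (u : V) v)
    (hqs : ∀ w ∈ q.support, w ∈ s) :
    ZPositionable (G.induce s) {z | (z : V) ∈ Z} u v := by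
  intro p hp hlen z hz hzp
  let f : G.induce s ↪g G := Embedding.induce s
  have hle : p.length ≤ G.dist (u : V) v := by
    have hlift : (q.induce s hqs).length = q.length :=
      (Walk.length_map f.toHom _).symm.trans (congrArg Walk.length (Walk.map_induce q hqs))
    rw [hlen, ← hq, ← hlift]
    exact dist_le _
  have hmap : (p.map f.toHom).length = G.dist (u : V) v :=
    le_antisymm ((p.length_map _).trans_le hle) (dist_le _)
  have hsupp : (z : V) ∈ (p.map f.toHom).support := by
    rw [Walk.support_map]
    exact List.mem_map_of_mem hzp
  exact (h _ (hp.map f.injective) hmap z hz hsupp).imp Subtype.ext Subtype.ext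

/-- If `X` is a dual general position set of the finite connected
graph `G` and `x ∈ X` is not a cut vertex of `G`, then `X \ {x}` is a dual
general position set of `G - x`. -/
theorem isDualGPSet_vertex_removal [Fintype V] (G : SimpleGraph V) (hG : G.Connected)
    (X : Set V) (hX : IsDualGPSet G X) (x : V) (hxX : x ∈ X)
    (hx : (G.induce {y : V | y ≠ x}).Connected) :
    IsDualGPSet (G.induce {y : V | y ≠ x})
      {z : {y : V // y ≠ x} | (z : V) ∈ X} := by
  have key : ∀ u v : {y : V | y ≠ x}, ZPositionable G X u v →
      ZPositionable (G.induce {y : V | y ≠ x}) {z | (z : V) ∈ X} u v := by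
    intro u v h
    obtain ⟨q, hq, hqlen⟩ := hG.exists_path_of_dist (u : V) v
    refine h.induce q hqlen fun w hw hwx => ?_
    subst hwx
    exact (h q hq hqlen w hxX hw).elim (fun e => u.2 e.symm) fun e => v.2 e.symm
  exact ⟨fun u hu v hv => key u v (hX.1 u hu v hv),
    fun u hu v hv => key u v (hX.2 u hu v hv)⟩
end

section
/- For every integer k ≥ 4, the mushroom graph M_k satisfies gp_d(M_k) = k + 2 and gp_d(M_k - x) = 0, where x is the center of the wheel in M_k. -/
open SimpleGraph

variable {V : Type*}

/-- The mushroom graph `M_k`: the wheel `W_{k+4}` (cycle `w_0, …, w_{k+3}` plus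
a center `x` adjacent to all cycle vertices) together with a complete graph `K_k`
on `v_0, …, v_{k-1}`, and the matching edges `v_i w_i` for `i < k`. -/
def mushroom (k : ℕ) : SimpleGraph (Fin (k + 4) ⊕ Unit ⊕ Fin k) :=
  SimpleGraph.fromRel fun a b =>
    match a, b with
    | .inl i, .inl j => i + 1 = j
    | .inr (.inl _), .inl _ => True
    | .inr (.inr _), .inr (.inr _) => True
    | .inr (.inr i), .inl j => j = Fin.castLE (Nat.le_add_right k 4) i
    | _, _ => False

section Geodesics

variable {G : SimpleGraph V} {Z : Set V} {a b c d : V}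

theorem dist_eq_two_of_adj_of_adj (hab : G.Adj a b) (hbc : G.Adj b c)
    (hne : a ≠ c) (hac : ¬ G.Adj a c) : G.dist a c = 2 := by
  have hw : (Walk.cons hab (Walk.cons hbc Walk.nil)).length = 2 := rfl
  have hle := dist_le (Walk.cons hab (Walk.cons hbc Walk.nil))
  have h0 : G.dist a c ≠ 0 := fun h =>
    hne ((Walk.reachable (Walk.cons hab (Walk.cons hbc Walk.nil))).dist_eq_zero_iff.1 h)
  have h1 : G.dist a c ≠ 1 := fun h => hac (dist_eq_one_iff_adj.1 h)
  omega

theorem dist_eq_three_of_adj_of_adj_of_adj (hab : G.Adj a b) (hbc : G.Adj b c)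
    (hcd : G.Adj c d) (hne : a ≠ d) (had : ¬ G.Adj a d)
    (hcommon : ∀ e, G.Adj a e → ¬ G.Adj e d) : G.dist a d = 3 := by
  let p := Walk.cons hab (Walk.cons hbc (Walk.cons hcd Walk.nil))
  have hw : p.length = 3 := rfl
  have hle := dist_le p
  have h0 : G.dist a d ≠ 0 := fun h => hne (p.reachable.dist_eq_zero_iff.1 h)
  have h1 : G.dist a d ≠ 1 := fun h => had (dist_eq_one_iff_adj.1 h)
  have h2 : G.dist a d ≠ 2 := fun h => by
    obtain ⟨q, hq⟩ := p.reachable.exists_walk_length_eq_dist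
    rw [h] at hq
    match q, hq with
    | .cons h₁ (.cons h₂ .nil), _ => exact hcommon _ h₁ h₂
  omega

theorem zPositionable_of_dist_add_dist_ne
    (h : ∀ z ∈ Z, z ≠ a → z ≠ b → G.dist a z + G.dist z b ≠ G.dist a b) :
    ZPositionable G Z a b := by
  classical
  intro p _ hlen z hz hzp
  by_contra hne
  push Not at hne
  have hsplit : (p.takeUntil z hzp).length + (p.dropUntil z hzp).length = p.length := by
    rw [← Walk.length_append, Walk.take_spec]
  have h₁ := dist_le (p.takeUntil z hzp)
  have h₂ := dist_le (p.dropUntil z hzp)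
  have h₃ := (p.takeUntil z hzp).reachable.dist_triangle_left b
  exact h z hz hne.1 hne.2 (by omega)

/-- A member of a dual general position set lying in the middle of a geodesic of length two
separates its endpoints. -/
theorem IsDualGPSet.mem_iff_notMem (hZ : IsDualGPSet G Z) (hab : G.Adj a b) (hbc : G.Adj b c)
    (hne : a ≠ c) (hac : ¬ G.Adj a c) (hb : b ∈ Z) : a ∈ Z ↔ c ∉ Z := by
  have hpos : ¬ ZPositionable G Z a c := fun h => by
    have := h (.cons hab (.cons hbc .nil)) (by simp [hab.ne, hbc.ne, hne])
      (dist_eq_two_of_adj_of_adj hab hbc hne hac).symm b hb (by simp)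
    exact this.elim hab.ne' hbc.ne
  refine ⟨fun ha hc => hpos (hZ.1 _ ha _ hc), fun hc => ?_⟩
  by_contra ha
  exact hpos (hZ.2 _ ha _ hc)

theorem IsDualGPSet.notMem_of_geodesic_three (hZ : IsDualGPSet G Z) (hab : G.Adj a b)
    (hbc : G.Adj b c) (hcd : G.Adj c d) (hne : a ≠ d) (had : ¬ G.Adj a d)
    (hcommon : ∀ e, G.Adj a e → ¬ G.Adj e d) (ha : a ∉ Z) (hd : d ∉ Z) : b ∉ Z := by
  intro hb
  have hac : a ≠ c := fun h => had (h ▸ hcd)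
  have hbd : b ≠ d := fun h => had (h ▸ hab)
  have := hZ.2 _ ha _ hd (.cons hab (.cons hbc (.cons hcd .nil)))
    (by simp [hab.ne, hbc.ne, hcd.ne, hne, hac, hbd])
    (dist_eq_three_of_adj_of_adj_of_adj hab hbc hcd hne had hcommon).symm b hb (by simp)
  exact this.elim hab.ne' hbd

end Geodesics

section Mushroom

variable {k : ℕ}

theorem fin_add_one_eq_iff {i j : Fin (k + 4)} :
    i + 1 = j ↔ i.val + 1 = j.val ∨ (i.val = k + 3 ∧ j.val = 0) := by
  rw [Fin.ext_iff, Fin.val_add_one]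
  have := i.isLt
  have := j.isLt
  split_ifs with h
  · rw [h, Fin.val_last]; omega
  · rw [Fin.ext_iff, Fin.val_last] at h; omega

theorem mushroom_adj_rim_rim {i j : Fin (k + 4)} :
    (mushroom k).Adj (.inl i) (.inl j) ↔
      (i.val + 1 = j.val ∨ (i.val = k + 3 ∧ j.val = 0)) ∨
      (j.val + 1 = i.val ∨ (j.val = k + 3 ∧ i.val = 0)) := by
  simp only [mushroom, fromRel_adj, fin_add_one_eq_iff, ne_eq, Sum.inl.injEq]
  rw [Fin.ext_iff]
  omega

theorem mushroom_adj_center_rim {u : Unit} {i : Fin (k + 4)} :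
    (mushroom k).Adj (.inr (.inl u)) (.inl i) := by
  simp [mushroom]

theorem mushroom_adj_rim_center {u : Unit} {i : Fin (k + 4)} :
    (mushroom k).Adj (.inl i) (.inr (.inl u)) :=
  mushroom_adj_center_rim.symm

theorem mushroom_adj_clique_clique {i j : Fin k} :
    (mushroom k).Adj (.inr (.inr i)) (.inr (.inr j)) ↔ i ≠ j := by
  simp [mushroom]

theorem mushroom_adj_clique_rim {i : Fin k} {j : Fin (k + 4)} :
    (mushroom k).Adj (.inr (.inr i)) (.inl j) ↔ j.val = i.val := by
  simp [mushroom, Fin.ext_iff]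

theorem mushroom_adj_rim_clique {i : Fin k} {j : Fin (k + 4)} :
    (mushroom k).Adj (.inl j) (.inr (.inr i)) ↔ j.val = i.val := by
  rw [adj_comm, mushroom_adj_clique_rim]

theorem not_mushroom_adj_center_center {u v : Unit} :
    ¬ (mushroom k).Adj (.inr (.inl u)) (.inr (.inl v)) := by
  simp [mushroom]

theorem not_mushroom_adj_center_clique {u : Unit} {i : Fin k} :
    ¬ (mushroom k).Adj (.inr (.inl u)) (.inr (.inr i)) := by
  simp [mushroom]

theorem not_mushroom_adj_clique_center {u : Unit} {i : Fin k} :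
    ¬ (mushroom k).Adj (.inr (.inr i)) (.inr (.inl u)) := by
  simp [mushroom]

/-- The clique vertices together with the two middle unmatched rim vertices. -/
def mushroomDualSet (k : ℕ) : Set (Fin (k + 4) ⊕ Unit ⊕ Fin k) :=
  {.inl ⟨k + 1, by omega⟩, .inl ⟨k + 2, by omega⟩} ∪ Set.range fun i => .inr (.inr i)

theorem rim_mem_mushroomDualSet {i : Fin (k + 4)} :
    .inl i ∈ mushroomDualSet k ↔ i.val = k + 1 ∨ i.val = k + 2 := by
  simp [mushroomDualSet, Fin.ext_iff]

theorem center_notMem_mushroomDualSet {u : Unit} : .inr (.inl u) ∉ mushroomDualSet k := by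
  simp [mushroomDualSet]

theorem clique_mem_mushroomDualSet {i : Fin k} : .inr (.inr i) ∈ mushroomDualSet k := by
  simp [mushroomDualSet]

theorem ncard_range_clique :
    (Set.range fun i : Fin k => (.inr (.inr i) : Fin (k + 4) ⊕ Unit ⊕ Fin k)).ncard = k := by
  rw [← Set.image_univ, Set.ncard_image_of_injective _ (by intro i j h; simpa using h)]
  simp

theorem ncard_mushroomDualSet : (mushroomDualSet k).ncard = k + 2 := by
  rw [mushroomDualSet, Set.ncard_union_eq (by
      rw [Set.disjoint_left]; rintro _ (rfl | rfl) <;> simp) (Set.toFinite _) (Set.toFinite _),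
    Set.ncard_pair (by simp), ncard_range_clique, add_comm]

theorem dist_clique_rim_mushroom {i : Fin k} {j : Fin (k + 4)}
    (hj : j.val = k + 1 ∨ j.val = k + 2) :
    (mushroom k).dist (.inr (.inr i)) (.inl j) = 3 := by
  have := i.isLt
  refine dist_eq_three_of_adj_of_adj_of_adj (b := .inl (Fin.castLE (Nat.le_add_right k 4) i))
    (c := .inr (.inl ())) (mushroom_adj_clique_rim.2 rfl) mushroom_adj_rim_center
    mushroom_adj_center_rim (by simp) (by rw [mushroom_adj_clique_rim]; omega) ?_
  rintro (m | _ | m) h₁ h₂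
  · rw [mushroom_adj_clique_rim] at h₁
    rw [mushroom_adj_rim_rim] at h₂
    omega
  · exact not_mushroom_adj_clique_center h₁
  · rw [mushroom_adj_clique_rim] at h₂
    omega

theorem dist_rim_mushroom_le_two {i j : Fin (k + 4)} :
    (mushroom k).dist (.inl i) (.inl j) ≤ 2 :=
  dist_le (Walk.cons mushroom_adj_rim_center (Walk.cons (mushroom_adj_center_rim (u := ())) .nil))

theorem connected_mushroom : (mushroom k).Connected := by
  refine (connected_iff_exists_forall_reachable _).2 ⟨.inr (.inl ()), ?_⟩
  rintro (i | _ | i)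
  · exact mushroom_adj_center_rim.reachable
  · exact Reachable.refl _
  · exact (mushroom_adj_center_rim (i := Fin.castLE (Nat.le_add_right k 4) i)).reachable.trans
      (mushroom_adj_rim_clique.2 rfl).reachable

theorem isDualGPSet_mushroomDualSet : IsDualGPSet (mushroom k) (mushroomDualSet k) := by
  have hww {i j : Fin (k + 4)} (hi : i.val = k + 1 ∨ i.val = k + 2)
      (hj : j.val = k + 1 ∨ j.val = k + 2) (hne : i.val ≠ j.val) :
      (mushroom k).dist (.inl i) (.inl j) = 1 :=
    dist_eq_one_iff_adj.2 (mushroom_adj_rim_rim.2 (by omega))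
  have hvv {i j : Fin k} (hne : i ≠ j) :
      (mushroom k).dist (.inr (.inr i)) (.inr (.inr j)) = 1 :=
    dist_eq_one_iff_adj.2 (mushroom_adj_clique_clique.2 hne)
  have hvw {i : Fin k} {j : Fin (k + 4)} (hj : j.val = k + 1 ∨ j.val = k + 2) :=
    dist_clique_rim_mushroom (i := i) hj
  have hwv {i : Fin k} {j : Fin (k + 4)} (hj : j.val = k + 1 ∨ j.val = k + 2) :
      (mushroom k).dist (.inl j) (.inr (.inr i)) = 3 := by
    rw [dist_comm, hvw hj]
  constructor
  · intro a ha b hb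
    refine zPositionable_of_dist_add_dist_ne fun z hz hza hzb => ?_
    have hpos {u v : Fin (k + 4) ⊕ Unit ⊕ Fin k} (h : u ≠ v) :=
      connected_mushroom.pos_dist_of_ne h
    have h₁ := hpos hza.symm
    have h₂ := hpos hzb
    rcases a with i | _ | i <;> rcases b with j | _ | j <;> rcases z with m | _ | m <;>
      simp only [rim_mem_mushroomDualSet, center_notMem_mushroomDualSet,
        clique_mem_mushroomDualSet] at ha hb hz
    · rcases eq_or_ne i j with rfl | h
      · rw [SimpleGraph.dist_self]; omega
      · rw [hww ha hb (by omega)]; omega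
    · rcases eq_or_ne i j with rfl | h
      · rw [SimpleGraph.dist_self]; omega
      · rw [hww ha hb (by omega)]; omega
    · rw [hwv ha, hwv hz]; omega
    · rw [hwv ha, hwv ha]; omega
    · rw [hvw hz, hvw hb]; omega
    · rw [hvw hb, hvw hb]; omega
    · rcases eq_or_ne i j with rfl | h
      · rw [SimpleGraph.dist_self]; omega
      · rw [hvv h]; omega
    · rcases eq_or_ne i j with rfl | h
      · rw [SimpleGraph.dist_self]; omega
      · rw [hvv h]; omega
  · intro a ha b hb
    refine zPositionable_of_dist_add_dist_ne fun z hz hza hzb hsum => ?_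
    have h₁ := connected_mushroom.pos_dist_of_ne hza.symm
    have h₂ := connected_mushroom.pos_dist_of_ne hzb
    have hle : (mushroom k).dist a b ≤ 2 := by
      rcases a with i | _ | i
      · rcases b with j | _ | j
        · exact dist_rim_mushroom_le_two
        · rw [dist_eq_one_iff_adj.2 mushroom_adj_rim_center]; omega
        · exact absurd clique_mem_mushroomDualSet hb
      · rcases b with j | _ | j
        · rw [dist_eq_one_iff_adj.2 mushroom_adj_center_rim]; omega
        · simp
        · exact absurd clique_mem_mushroomDualSet hb
      · exact absurd clique_mem_mushroomDualSet ha
    have haz : (mushroom k).Adj a z := dist_eq_one_iff_adj.1 (by omega)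
    have hzb' : (mushroom k).Adj z b := dist_eq_one_iff_adj.1 (by omega)
    have hnadj : ¬ (mushroom k).Adj a b := fun h => by
      rw [dist_eq_one_iff_adj.2 h] at hsum; omega
    have hne : a ≠ b := by
      rintro rfl
      rw [SimpleGraph.dist_self] at hsum; omega
    rcases a with i | _ | i <;> rcases b with j | _ | j <;> rcases z with m | _ | m <;>
      simp only [rim_mem_mushroomDualSet, center_notMem_mushroomDualSet,
        clique_mem_mushroomDualSet, mushroom_adj_rim_rim, mushroom_adj_center_rim,
        mushroom_adj_rim_center, mushroom_adj_clique_rim,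
        mushroom_adj_rim_clique, not_mushroom_adj_center_center, not_mushroom_adj_center_clique,
        not_mushroom_adj_clique_center, ne_eq, Sum.inl.injEq, Fin.ext_iff, not_true_eq_false]
        at ha hb hz haz hzb' hnadj hne <;> omega

theorem center_notMem_of_isDualGPSet (hk : 4 ≤ k) {Z : Set (Fin (k + 4) ⊕ Unit ⊕ Fin k)}
    (hZ : IsDualGPSet (mushroom k) Z) : .inr (.inl ()) ∉ Z := by
  intro hx
  have key (i j : Fin (k + 4)) (h : i.val + 1 < j.val) (h' : j.val < k + 3 + i.val) :
      .inl i ∈ Z ↔ .inl j ∉ Z :=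
    hZ.mem_iff_notMem mushroom_adj_rim_center mushroom_adj_center_rim
      (by simp [Fin.ext_iff]; omega) (by rw [mushroom_adj_rim_rim]; omega) hx
  have h₁ := key ⟨0, by omega⟩ ⟨2, by omega⟩ (by simp) (by simp)
  have h₂ := key ⟨0, by omega⟩ ⟨4, by omega⟩ (by simp) (by simp; omega)
  have h₃ := key ⟨2, by omega⟩ ⟨4, by omega⟩ (by simp) (by dsimp only; omega)
  tauto

theorem exists_rim_cyclic_neighbors (i : Fin (k + 4)) :
    ∃ p s : Fin (k + 4), (p.val + 1 = i.val ∨ (p.val = k + 3 ∧ i.val = 0)) ∧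
      (i.val + 1 = s.val ∨ (i.val = k + 3 ∧ s.val = 0)) := by
  refine ⟨i - 1, i + 1, fin_add_one_eq_iff.1 (by simp), fin_add_one_eq_iff.1 rfl⟩

theorem fin_eq_of_le_val {i : Fin (k + 4)} (hi : k ≤ i.val) :
    i = ⟨k, by simp⟩ ∨ i = ⟨k + 1, by simp⟩ ∨ i = ⟨k + 2, by simp⟩ ∨ i = ⟨k + 3, by simp⟩ := by
  simp only [Fin.ext_iff]
  omega

theorem exists_subset_of_isDualGPSet_mushroom (hk : 4 ≤ k)
    {Z : Set (Fin (k + 4) ⊕ Unit ⊕ Fin k)} (hZ : IsDualGPSet (mushroom k) Z) :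
    ∃ i j : Fin (k + 4), Z ⊆ {.inl i, .inl j} ∪ Set.range fun i => .inr (.inr i) := by
  have hx := center_notMem_of_isDualGPSet hk hZ
  have hcyc {p i s : Fin (k + 4)} (hp : p.val + 1 = i.val ∨ (p.val = k + 3 ∧ i.val = 0))
      (hs : i.val + 1 = s.val ∨ (i.val = k + 3 ∧ s.val = 0)) (hi : .inl i ∈ Z) :
      .inl p ∈ Z ↔ .inl s ∉ Z :=
    hZ.mem_iff_notMem (mushroom_adj_rim_rim.2 (.inl hp)) (mushroom_adj_rim_rim.2 (.inl hs))
      (by simp only [ne_eq, Sum.inl.injEq, Fin.ext_iff]; omega)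
      (by rw [mushroom_adj_rim_rim]; omega) hi
  have hmatched (i : Fin (k + 4)) (hik : i.val < k) : .inl i ∉ Z := by
    intro hi
    have hv : .inr (.inr ⟨i.val, hik⟩) ∈ Z :=
      (hZ.mem_iff_notMem (mushroom_adj_rim_clique (i := ⟨i.val, hik⟩).2 rfl).symm
        mushroom_adj_rim_center (by simp) not_mushroom_adj_clique_center hi).2 hx
    have hnbr (j : Fin (k + 4)) (hij : (mushroom k).Adj (.inl i) (.inl j)) : .inl j ∉ Z :=
      (hZ.mem_iff_notMem (mushroom_adj_rim_clique (i := ⟨i.val, hik⟩).2 rfl).symm hij (by simp)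
        (by rw [mushroom_adj_clique_rim]; rw [mushroom_adj_rim_rim] at hij; dsimp only; omega)
        hi).1 hv
    obtain ⟨p, s, hp, hs⟩ := exists_rim_cyclic_neighbors i
    exact hnbr p (mushroom_adj_rim_rim.2 (.inr hp))
      ((hcyc hp hs hi).2 (hnbr s (mushroom_adj_rim_rim.2 (.inl hs))))
  have h₀ := hmatched ⟨0, by omega⟩ (by dsimp only; omega)
  have h₁ := hmatched ⟨k - 1, by omega⟩ (by dsimp only; omega)
  have c₁ := hcyc (p := ⟨k - 1, by omega⟩) (i := ⟨k, by omega⟩) (s := ⟨k + 1, by omega⟩)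
    (by dsimp only; omega) (by simp)
  have c₂ := hcyc (p := ⟨k, by omega⟩) (i := ⟨k + 1, by omega⟩) (s := ⟨k + 2, by omega⟩)
    (by simp) (by simp)
  have c₃ := hcyc (p := ⟨k + 1, by omega⟩) (i := ⟨k + 2, by omega⟩) (s := ⟨k + 3, by omega⟩)
    (by simp) (by simp)
  have c₄ := hcyc (p := ⟨k + 2, by omega⟩) (i := ⟨k + 3, by omega⟩) (s := ⟨0, by omega⟩)
    (by simp) (by simp)
  have hcover (a b : Fin (k + 4))
      (h : ∀ i : Fin (k + 4), k ≤ i.val → .inl i ∈ Z → i = a ∨ i = b) :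
      Z ⊆ {.inl a, .inl b} ∪ Set.range fun i => .inr (.inr i) := by
    rintro (i | _ | i) hi
    · have : i = a ∨ i = b := h i (by by_contra hlt; exact hmatched i (by omega) hi) hi
      simpa using this
    · exact absurd hi hx
    · simp
  by_cases m₁ : .inl ⟨k, by omega⟩ ∈ Z
  · have m₂ := not_not.1 (mt (c₁ m₁).2 h₁)
    have m₃ := (c₂ m₂).1 m₁
    refine ⟨⟨k, by omega⟩, ⟨k + 1, by omega⟩, hcover _ _ fun i hik hi => ?_⟩
    rcases fin_eq_of_le_val hik with rfl | rfl | rfl | rfl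
    · exact .inl rfl
    · exact .inr rfl
    · exact absurd hi m₃
    · exact absurd ((c₄ hi).2 h₀) m₃
  by_cases m₂ : .inl ⟨k + 1, by omega⟩ ∈ Z
  · have m₃ := not_not.1 (mt (c₂ m₂).2 m₁)
    refine ⟨⟨k + 1, by omega⟩, ⟨k + 2, by omega⟩, hcover _ _ fun i hik hi => ?_⟩
    rcases fin_eq_of_le_val hik with rfl | rfl | rfl | rfl
    · exact absurd hi m₁
    · exact .inl rfl
    · exact .inr rfl
    · exact absurd hi ((c₃ m₃).1 m₂)
  · refine ⟨⟨k + 2, by omega⟩, ⟨k + 3, by omega⟩, hcover _ _ fun i hik hi => ?_⟩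
    rcases fin_eq_of_le_val hik with rfl | rfl | rfl | rfl
    · exact absurd hi m₁
    · exact absurd hi m₂
    · exact .inl rfl
    · exact .inr rfl

theorem ncard_le_of_isDualGPSet_mushroom (hk : 4 ≤ k) {Z : Set (Fin (k + 4) ⊕ Unit ⊕ Fin k)}
    (hZ : IsDualGPSet (mushroom k) Z) : Z.ncard ≤ k + 2 := by
  obtain ⟨i, j, hij⟩ := exists_subset_of_isDualGPSet_mushroom hk hZ
  calc Z.ncard ≤ _ := Set.ncard_le_ncard hij (Set.toFinite _)
    _ ≤ _ := Set.ncard_union_le _ _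
    _ ≤ 2 + k := Nat.add_le_add (Set.ncard_insert_le _ _ |>.trans (by simp)) ncard_range_clique.le
    _ = k + 2 := add_comm _ _

/-- The mushroom graph with the center of its wheel removed. -/
abbrev mushroomMinusCenter (k : ℕ) :
    SimpleGraph {y : Fin (k + 4) ⊕ Unit ⊕ Fin k | y ≠ Sum.inr (Sum.inl ())} :=
  (mushroom k).induce {y | y ≠ Sum.inr (Sum.inl ())}

/-- A rim vertex of the mushroom without its center. -/
def rimVertex (i : Fin (k + 4)) :
    {y : Fin (k + 4) ⊕ Unit ⊕ Fin k | y ≠ Sum.inr (Sum.inl ())} :=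
  ⟨.inl i, by simp⟩

/-- A clique vertex of the mushroom without its center. -/
def cliqueVertex (i : Fin k) :
    {y : Fin (k + 4) ⊕ Unit ⊕ Fin k | y ≠ Sum.inr (Sum.inl ())} :=
  ⟨.inr (.inr i), by simp⟩

theorem rimVertex_or_cliqueVertex
    (y : {y : Fin (k + 4) ⊕ Unit ⊕ Fin k | y ≠ Sum.inr (Sum.inl ())}) :
    (∃ i, y = rimVertex i) ∨ ∃ i, y = cliqueVertex i := by
  obtain ⟨i | _ | i, hy⟩ := y
  · exact .inl ⟨i, rfl⟩
  · exact absurd rfl hy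
  · exact .inr ⟨i, rfl⟩

theorem rimVertex_inj {i j : Fin (k + 4)} : rimVertex i = rimVertex j ↔ i.val = j.val := by
  simp [rimVertex, Fin.ext_iff]

theorem cliqueVertex_ne_rimVertex {i : Fin k} {j : Fin (k + 4)} :
    cliqueVertex i ≠ rimVertex j := by
  simp [rimVertex, cliqueVertex]

theorem adj_rimVertex_rimVertex {i j : Fin (k + 4)} :
    (mushroomMinusCenter k).Adj (rimVertex i) (rimVertex j) ↔
      (i.val + 1 = j.val ∨ (i.val = k + 3 ∧ j.val = 0)) ∨
      (j.val + 1 = i.val ∨ (j.val = k + 3 ∧ i.val = 0)) :=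
  mushroom_adj_rim_rim

theorem adj_cliqueVertex_cliqueVertex {i j : Fin k} :
    (mushroomMinusCenter k).Adj (cliqueVertex i) (cliqueVertex j) ↔ i ≠ j :=
  mushroom_adj_clique_clique

theorem adj_cliqueVertex_rimVertex {i : Fin k} {j : Fin (k + 4)} :
    (mushroomMinusCenter k).Adj (cliqueVertex i) (rimVertex j) ↔ j.val = i.val :=
  mushroom_adj_clique_rim

theorem adj_rimVertex_cliqueVertex {i : Fin k} {j : Fin (k + 4)} :
    (mushroomMinusCenter k).Adj (rimVertex j) (cliqueVertex i) ↔ j.val = i.val :=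
  mushroom_adj_rim_clique

section DualSets

variable {Z : Set {y : Fin (k + 4) ⊕ Unit ⊕ Fin k | y ≠ Sum.inr (Sum.inl ())}}

theorem rimVertex_pred_mem_iff_succ_notMem (hk : 4 ≤ k)
    (hZ : IsDualGPSet (mushroomMinusCenter k) Z) {p i s : Fin (k + 4)}
    (hp : p.val + 1 = i.val ∨ (p.val = k + 3 ∧ i.val = 0))
    (hs : i.val + 1 = s.val ∨ (i.val = k + 3 ∧ s.val = 0)) (hi : rimVertex i ∈ Z) :
    rimVertex p ∈ Z ↔ rimVertex s ∉ Z :=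
  hZ.mem_iff_notMem (adj_rimVertex_rimVertex.2 (.inl hp)) (adj_rimVertex_rimVertex.2 (.inl hs))
    (by rw [ne_eq, rimVertex_inj]; omega) (by rw [adj_rimVertex_rimVertex]; omega) hi

theorem not_adj_rimVertex_of_adj_rimVertex (hk : 4 ≤ k) {a d : Fin (k + 4)}
    (h : a.val + 3 = d.val ∨ (a.val = k + 1 ∧ d.val = 0)) (e) :
    (mushroomMinusCenter k).Adj (rimVertex a) e →
      ¬ (mushroomMinusCenter k).Adj e (rimVertex d) := by
  obtain ⟨i, rfl⟩ | ⟨i, rfl⟩ := rimVertex_or_cliqueVertex e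
  · rw [adj_rimVertex_rimVertex, adj_rimVertex_rimVertex]; omega
  · rw [adj_rimVertex_cliqueVertex, adj_cliqueVertex_rimVertex]; omega

theorem rimVertex_notMem_of_isDualGPSet_of_notMem (hk : 4 ≤ k)
    (hZ : IsDualGPSet (mushroomMinusCenter k) Z) {a b c d : Fin (k + 4)}
    (hab : a.val + 1 = b.val) (hbc : b.val + 1 = c.val)
    (hcd : c.val + 1 = d.val ∨ (c.val = k + 3 ∧ d.val = 0))
    (ha : rimVertex a ∉ Z) (hd : rimVertex d ∉ Z) : rimVertex b ∉ Z :=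
  hZ.notMem_of_geodesic_three (adj_rimVertex_rimVertex.2 (.inl (.inl hab)))
    (adj_rimVertex_rimVertex.2 (.inl (.inl hbc))) (adj_rimVertex_rimVertex.2 (.inl hcd))
    (by rw [ne_eq, rimVertex_inj]; omega) (by rw [adj_rimVertex_rimVertex]; omega)
    (not_adj_rimVertex_of_adj_rimVertex hk (by omega)) ha hd

theorem cliqueVertex_notMem_of_isDualGPSet (hk : 4 ≤ k)
    (hZ : IsDualGPSet (mushroomMinusCenter k) Z) (i : Fin k) : cliqueVertex i ∉ Z := by
  intro hi
  have hside {i j : Fin k} {r : Fin (k + 4)} (hr : r.val = i.val) (hij : i ≠ j)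
      (hi : cliqueVertex i ∈ Z) : cliqueVertex j ∈ Z ↔ rimVertex r ∉ Z :=
    hZ.mem_iff_notMem (adj_cliqueVertex_cliqueVertex.2 hij.symm)
      (adj_cliqueVertex_rimVertex.2 hr) cliqueVertex_ne_rimVertex
      (by rw [adj_cliqueVertex_rimVertex]; rw [ne_eq, Fin.ext_iff] at hij; omega) hi
  have hrim {i : Fin k} {r : Fin (k + 4)} (hr : r.val = i.val) (hi : cliqueVertex i ∈ Z) :
      rimVertex r ∉ Z := by
    intro hrZ
    have hnbr (j : Fin (k + 4)) (hij : (mushroomMinusCenter k).Adj (rimVertex r) (rimVertex j)) :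
        rimVertex j ∉ Z :=
      (hZ.mem_iff_notMem (adj_cliqueVertex_rimVertex.2 hr) hij cliqueVertex_ne_rimVertex
        (by rw [adj_cliqueVertex_rimVertex]; rw [adj_rimVertex_rimVertex] at hij; omega)
        hrZ).1 hi
    obtain ⟨p, s, hp, hs⟩ := exists_rim_cyclic_neighbors r
    exact hnbr p (adj_rimVertex_rimVertex.2 (.inr hp))
      ((rimVertex_pred_mem_iff_succ_notMem hk hZ hp hs hrZ).2
        (hnbr s (adj_rimVertex_rimVertex.2 (.inl hs))))
  have hall (j : Fin k) : cliqueVertex j ∈ Z := by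
    by_cases hij : i = j
    · exact hij ▸ hi
    · exact (hside (r := Fin.castLE (Nat.le_add_right k 4) i) rfl hij hi).2 (hrim rfl hi)
  exact hZ.notMem_of_geodesic_three (a := rimVertex ⟨0, by omega⟩)
    (b := cliqueVertex ⟨0, by omega⟩) (c := cliqueVertex ⟨3, by omega⟩)
    (d := rimVertex ⟨3, by omega⟩) (adj_rimVertex_cliqueVertex.2 rfl)
    (adj_cliqueVertex_cliqueVertex.2 (by simp)) (adj_cliqueVertex_rimVertex.2 rfl)
    (by simp [rimVertex_inj]) (by rw [adj_rimVertex_rimVertex]; dsimp only; omega)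
    (not_adj_rimVertex_of_adj_rimVertex hk (by simp))
    (hrim (i := ⟨0, by omega⟩) rfl (hall _)) (hrim (i := ⟨3, by omega⟩) rfl (hall _)) (hall _)

theorem rimVertex_notMem_of_isDualGPSet (hk : 4 ≤ k)
    (hZ : IsDualGPSet (mushroomMinusCenter k) Z) (i : Fin (k + 4)) : rimVertex i ∉ Z := by
  have hmatched (i : Fin (k + 4)) (hik : i.val < k) : rimVertex i ∉ Z := by
    intro hi
    have hv := cliqueVertex_notMem_of_isDualGPSet hk hZ ⟨i.val, hik⟩
    have hnbr (j : Fin (k + 4)) (hij : (mushroomMinusCenter k).Adj (rimVertex i) (rimVertex j)) :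
        rimVertex j ∈ Z := by
      by_contra hj
      exact hv ((hZ.mem_iff_notMem (adj_cliqueVertex_rimVertex.2 rfl) hij
        cliqueVertex_ne_rimVertex (by
          rw [adj_cliqueVertex_rimVertex]; rw [adj_rimVertex_rimVertex] at hij
          dsimp only; omega) hi).2 hj)
    obtain ⟨p, s, hp, hs⟩ := exists_rim_cyclic_neighbors i
    exact (rimVertex_pred_mem_iff_succ_notMem hk hZ hp hs hi).1
      (hnbr p (adj_rimVertex_rimVertex.2 (.inr hp)))
      (hnbr s (adj_rimVertex_rimVertex.2 (.inl hs)))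
  have h₀ := hmatched ⟨0, by omega⟩ (by dsimp only; omega)
  have h₁ := hmatched ⟨k - 1, by omega⟩ (by dsimp only; omega)
  have c₁ := rimVertex_pred_mem_iff_succ_notMem hk hZ (p := ⟨k - 1, by omega⟩)
    (i := ⟨k, by omega⟩) (s := ⟨k + 1, by omega⟩) (by dsimp only; omega) (by simp)
  have c₂ := rimVertex_pred_mem_iff_succ_notMem hk hZ (p := ⟨k, by omega⟩)
    (i := ⟨k + 1, by omega⟩) (s := ⟨k + 2, by omega⟩) (by simp) (by simp)
  have c₃ := rimVertex_pred_mem_iff_succ_notMem hk hZ (p := ⟨k + 1, by omega⟩)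
    (i := ⟨k + 2, by omega⟩) (s := ⟨k + 3, by omega⟩) (by simp) (by simp)
  have c₄ := rimVertex_pred_mem_iff_succ_notMem hk hZ (p := ⟨k + 2, by omega⟩)
    (i := ⟨k + 3, by omega⟩) (s := ⟨0, by omega⟩) (by simp) (by simp)
  have g₁ := rimVertex_notMem_of_isDualGPSet_of_notMem hk hZ (a := ⟨k - 1, by omega⟩)
    (b := ⟨k, by omega⟩) (c := ⟨k + 1, by omega⟩) (d := ⟨k + 2, by omega⟩)
    (by dsimp only; omega) (by simp) (by simp)
  have g₂ := rimVertex_notMem_of_isDualGPSet_of_notMem hk hZ (a := ⟨k, by omega⟩)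
    (b := ⟨k + 1, by omega⟩) (c := ⟨k + 2, by omega⟩) (d := ⟨k + 3, by omega⟩)
    (by simp) (by simp) (by simp)
  have g₃ := rimVertex_notMem_of_isDualGPSet_of_notMem hk hZ (a := ⟨k + 1, by omega⟩)
    (b := ⟨k + 2, by omega⟩) (c := ⟨k + 3, by omega⟩) (d := ⟨0, by omega⟩)
    (by simp) (by simp) (by simp)
  by_cases hik : i.val < k
  · exact hmatched i hik
  have n₁ : rimVertex ⟨k, by omega⟩ ∉ Z := fun h =>
    g₁ h₁ ((c₂ (not_not.1 (mt (c₁ h).2 h₁))).1 h) h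
  have n₂ : rimVertex ⟨k + 1, by omega⟩ ∉ Z := fun h =>
    g₂ n₁ ((c₃ (not_not.1 (mt (c₂ h).2 n₁))).1 h) h
  have n₃ := g₃ n₂ h₀
  rcases fin_eq_of_le_val (not_lt.1 hik) with rfl | rfl | rfl | rfl
  · exact n₁
  · exact n₂
  · exact n₃
  · exact fun h => n₃ ((c₄ h).2 h₀)

theorem eq_empty_of_isDualGPSet_mushroomMinusCenter (hk : 4 ≤ k)
    (hZ : IsDualGPSet (mushroomMinusCenter k) Z) : Z = ∅ := by
  refine Set.eq_empty_of_forall_notMem fun y => ?_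
  obtain ⟨i, rfl⟩ | ⟨i, rfl⟩ := rimVertex_or_cliqueVertex y
  · exact rimVertex_notMem_of_isDualGPSet hk hZ i
  · exact cliqueVertex_notMem_of_isDualGPSet hk hZ i

end DualSets

end Mushroom

/-- For `k ≥ 4`, `gp_d(M_k) = k + 2` and `gp_d(M_k - x) = 0`,
where `x` is the center of the wheel. -/
theorem mushroom_gpd (k : ℕ) (hk : 4 ≤ k) :
    gpd (mushroom k) = k + 2 ∧
    gpd ((mushroom k).induce {y | y ≠ Sum.inr (Sum.inl ())}) = 0 := by
  constructor
  · refine IsGreatest.csSup_eq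
      ⟨⟨mushroomDualSet k, isDualGPSet_mushroomDualSet, ncard_mushroomDualSet⟩, ?_⟩
    rintro _ ⟨Z, hZ, rfl⟩
    exact ncard_le_of_isDualGPSet_mushroom hk hZ
  · refine Nat.le_zero.1 (csSup_le' ?_)
    rintro _ ⟨Z, hZ, rfl⟩
    rw [eq_empty_of_isDualGPSet_mushroomMinusCenter hk hZ, Set.ncard_empty]
end

section
/- For every integer k ≥ 3, the graph T_k satisfies gp_d(T_k) = k and gp_d(T_k - x) = 2k. -/
open SimpleGraph

variable {V : Type*}

/-- The graph `T_k`: a star with center `u = Sum.inl ()` and leaves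
`v_0, …, v_{2k-1}`, together with an extra vertex `x = Sum.inr (Sum.inr ())`
adjacent exactly to `v_0, …, v_{k-1}`. -/
def Tgraph (k : ℕ) : SimpleGraph (Unit ⊕ Fin (2 * k) ⊕ Unit) :=
  SimpleGraph.fromRel fun a b =>
    match a, b with
    | .inl _, .inr (.inl _) => True
    | .inr (.inr _), .inr (.inl i) => (i : ℕ) < k
    | _, _ => False

/-- A vertex all of whose neighbors coincide is not an internal vertex of any path. -/
theorem SimpleGraph.Walk.IsPath.eq_or_eq_of_neighbors_eq {G : SimpleGraph V} {z : V}
    (hz : ∀ a b, G.Adj z a → G.Adj z b → a = b) {x y : V} {p : G.Walk x y} (hp : p.IsPath)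
    (hzp : z ∈ p.support) : z = x ∨ z = y := by
  induction p with
  | nil => simpa using hzp
  | @cons x w y h p ih =>
    rw [Walk.cons_isPath_iff] at hp
    rw [Walk.support_cons, List.mem_cons] at hzp
    rcases hzp with rfl | hzp
    · exact Or.inl rfl
    · rcases ih hp.1 hzp with rfl | rfl
      · cases p with
        | nil => exact Or.inr rfl
        | cons h' q =>
          refine absurd ?_ hp.2
          rw [hz _ _ h.symm h']
          simp
      · exact Or.inr rfl

/-- A set of vertices each having at most one neighbor is a dual general position set. -/
theorem isDualGPSet_of_neighbors_eq {G : SimpleGraph V} {Z : Set V}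
    (hZ : ∀ z ∈ Z, ∀ a b, G.Adj z a → G.Adj z b → a = b) : IsDualGPSet G Z :=
  ⟨fun _ _ _ _ _ hp _ z hz hzp => hp.eq_or_eq_of_neighbors_eq (hZ z hz) hzp,
    fun _ _ _ _ _ hp _ z hz hzp => hp.eq_or_eq_of_neighbors_eq (hZ z hz) hzp⟩

/-- A common neighbor of two distinct nonadjacent `Z`-positionable vertices is not in `Z`. -/
theorem ZPositionable.notMem {G : SimpleGraph V} {Z : Set V} {a b z : V}
    (h : ZPositionable G Z a b) (haz : G.Adj a z) (hzb : G.Adj z b) (hne : a ≠ b)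
    (hab : ¬ G.Adj a b) : z ∉ Z := by
  intro hz
  let p : G.Walk a b := .cons haz (.cons hzb .nil)
  have hp : p.IsPath := by
    simp [p, Walk.cons_isPath_iff, haz.ne, hzb.ne, hne]
  have hle : G.dist a b ≤ 2 := SimpleGraph.dist_le p
  have h0 : G.dist a b ≠ 0 := fun h0 => hne (p.reachable.dist_eq_zero_iff.mp h0)
  have h1 : G.dist a b ≠ 1 := fun h1 => hab (SimpleGraph.dist_eq_one_iff_adj.mp h1)
  have hl : p.length = G.dist a b := by
    change 2 = _
    omega
  rcases h p hp hl z hz (by simp [p]) with rfl | rfl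
  · exact haz.ne rfl
  · exact hzb.ne rfl

/-- A vertex with three pairwise nonadjacent neighbors belongs to no dual general position set. -/
theorem IsDualGPSet.notMem_of_three_neighbors {G : SimpleGraph V} {Z : Set V}
    (h : IsDualGPSet G Z) {z a b c : V} (ha : G.Adj z a) (hb : G.Adj z b) (hc : G.Adj z c)
    (hab : a ≠ b) (hac : a ≠ c) (hbc : b ≠ c) (hab' : ¬ G.Adj a b) (hac' : ¬ G.Adj a c)
    (hbc' : ¬ G.Adj b c) : z ∉ Z := by
  have key : ∀ {s t : V}, G.Adj z s → G.Adj z t → s ≠ t → ¬ G.Adj s t → (s ∈ Z ↔ t ∈ Z) →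
      z ∉ Z := by
    intro s t hs ht hne hst hiff
    by_cases hsZ : s ∈ Z
    · exact (h.1 s hsZ t (hiff.mp hsZ)).notMem hs.symm ht hne hst
    · exact (h.2 s hsZ t (fun htZ => hsZ (hiff.mpr htZ))).notMem hs.symm ht hne hst
  by_cases h₁ : a ∈ Z ↔ b ∈ Z
  · exact key ha hb hab hab' h₁
  by_cases h₂ : a ∈ Z ↔ c ∈ Z
  · exact key ha hc hac hac' h₂
  exact key hb hc hbc hbc' (by tauto)

theorem gpd_eq_of_forall_subset {G : SimpleGraph V} {W : Set V} (hfin : W.Finite)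
    (hW : IsDualGPSet G W) (hsub : ∀ Z, IsDualGPSet G Z → Z ⊆ W) : gpd G = W.ncard :=
  IsGreatest.csSup_eq ⟨⟨W, hW, rfl⟩, by
    rintro _ ⟨Z, hZ, rfl⟩
    exact Set.ncard_le_ncard (hsub Z hZ) hfin⟩

namespace Tgraph

variable {k : ℕ}

theorem adj_center (t : Unit) (i : Fin (2 * k)) :
    (Tgraph k).Adj (.inl t) (.inr (.inl i)) := by
  simp [Tgraph]

theorem adj_apex_iff (t : Unit) (i : Fin (2 * k)) :
    (Tgraph k).Adj (.inr (.inr t)) (.inr (.inl i)) ↔ (i : ℕ) < k := by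
  simp [Tgraph]

theorem not_adj_middle (i j : Fin (2 * k)) :
    ¬ (Tgraph k).Adj (.inr (.inl i)) (.inr (.inl j)) := by
  simp [Tgraph]

theorem not_adj_center_apex (s t : Unit) :
    ¬ (Tgraph k).Adj (.inl s) (.inr (.inr t)) := by
  simp [Tgraph]

theorem gpd_eq (hk : 3 ≤ k) : gpd (Tgraph k) = k := by
  let f : Fin k → Unit ⊕ Fin (2 * k) ⊕ Unit := fun i => .inr (.inl ⟨i + k, by omega⟩)
  have hf : Function.Injective f := by
    intro i j hij
    simpa [f, Fin.ext_iff] using hij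
  rw [gpd_eq_of_forall_subset (Set.finite_range f), Set.ncard_range_of_injective hf,
    Nat.card_eq_fintype_card, Fintype.card_fin]
  · apply isDualGPSet_of_neighbors_eq
    rintro _ ⟨i, rfl⟩
    have hi : ∀ a, (Tgraph k).Adj (f i) a → a = .inl () := by
      rintro (a | a | a) ha
      · rfl
      · exact absurd ha (not_adj_middle _ _)
      · have := (adj_apex_iff _ _).mp ha.symm
        simp at this
    intro a b ha hb
    rw [hi a ha, hi b hb]
  · intro Z hZ
    let v : Fin 3 → Fin (2 * k) := fun i => ⟨i, by omega⟩
    have hv : ∀ i j, i ≠ j →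
        (.inr (.inl (v i)) : Unit ⊕ Fin (2 * k) ⊕ Unit) ≠ .inr (.inl (v j)) := by
      intro i j hij h
      apply hij
      simpa [v, Fin.ext_iff] using h
    have hu (t : Unit) : Sum.inl t ∉ Z :=
      hZ.notMem_of_three_neighbors (adj_center t (v 0)) (adj_center t (v 1)) (adj_center t (v 2))
        (hv _ _ (by decide)) (hv _ _ (by decide)) (hv _ _ (by decide))
        (not_adj_middle _ _) (not_adj_middle _ _) (not_adj_middle _ _)
    have hvk (i : Fin 3) : (v i : ℕ) < k := by
      change (i : ℕ) < k
      omega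
    have hx (t : Unit) : Sum.inr (Sum.inr t) ∉ Z :=
      hZ.notMem_of_three_neighbors ((adj_apex_iff t (v 0)).mpr (hvk 0))
        ((adj_apex_iff t (v 1)).mpr (hvk 1)) ((adj_apex_iff t (v 2)).mpr (hvk 2))
        (hv _ _ (by decide)) (hv _ _ (by decide)) (hv _ _ (by decide))
        (not_adj_middle _ _) (not_adj_middle _ _) (not_adj_middle _ _)
    rintro (t | i | t) hz
    · exact absurd hz (hu t)
    · by_cases hi : (i : ℕ) < k
      · exact absurd hz ((hZ.2 _ (hu ()) _ (hx ())).notMem (adj_center () i)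
          ((adj_apex_iff () i).mpr hi).symm (by simp) (not_adj_center_apex _ _))
      · refine ⟨⟨i - k, by omega⟩, ?_⟩
        simp only [f, Sum.inr.injEq, Sum.inl.injEq, Fin.ext_iff]
        omega
    · exact absurd hz (hx t)

theorem gpd_induce_eq (hk : 3 ≤ k) :
    gpd ((Tgraph k).induce {y | y ≠ Sum.inr (Sum.inr ())}) = 2 * k := by
  let f : Fin (2 * k) → {y : Unit ⊕ Fin (2 * k) ⊕ Unit | y ≠ Sum.inr (Sum.inr ())} :=
    fun i => ⟨.inr (.inl i), by simp⟩
  have hf : Function.Injective f := by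
    intro i j hij
    simpa [f] using hij
  rw [gpd_eq_of_forall_subset (Set.finite_range f), Set.ncard_range_of_injective hf,
    Nat.card_eq_fintype_card, Fintype.card_fin]
  · apply isDualGPSet_of_neighbors_eq
    rintro _ ⟨i, rfl⟩
    have hi : ∀ a, ((Tgraph k).induce {y | y ≠ Sum.inr (Sum.inr ())}).Adj (f i) a →
        a.1 = .inl () := by
      rintro ⟨a | a | a, h⟩ ha
      · rfl
      · exact absurd ha (not_adj_middle _ _)
      · exact absurd rfl h
    intro a b ha hb
    exact Subtype.ext ((hi a ha).trans (hi b hb).symm)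
  · intro Z hZ
    let v : Fin 3 → Fin (2 * k) := fun i => ⟨i, by omega⟩
    have hv : ∀ i j, i ≠ j → f (v i) ≠ f (v j) := by
      intro i j hij h
      apply hij
      simpa [v, Fin.ext_iff] using hf h
    rintro ⟨t | i | t, h⟩ hz
    · exact absurd hz (hZ.notMem_of_three_neighbors (a := f (v 0)) (b := f (v 1)) (c := f (v 2))
        (adj_center t (v 0)) (adj_center t (v 1)) (adj_center t (v 2))
        (hv _ _ (by decide)) (hv _ _ (by decide)) (hv _ _ (by decide))
        (not_adj_middle _ _) (not_adj_middle _ _) (not_adj_middle _ _))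
    · exact ⟨i, rfl⟩
    · exact absurd rfl h

end Tgraph

/-- For `k ≥ 3`, `gp_d(T_k) = k` and `gp_d(T_k - x) = 2k`. -/
theorem Tgraph_gpd (k : ℕ) (hk : 3 ≤ k) :
    gpd (Tgraph k) = k ∧
    gpd ((Tgraph k).induce {y | y ≠ Sum.inr (Sum.inr ())}) = 2 * k := by
  exact ⟨Tgraph.gpd_eq hk, Tgraph.gpd_induce_eq hk⟩
end

section
/- For every integer k ≥ 2, the graph Y_k satisfies gp_d(Y_k) = 5 and gp_d(Y_k - x) = k + 3. -/
open SimpleGraph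

variable {V : Type*}

/-- The graph `Y_k`: a complete graph on the `k + 3` vertices
`v_0, …, v_{k-1}` (the `Fin k` part) and `u, v, w` (the `Fin 3` part),
together with two nonadjacent vertices `x = Sum.inr 0` and `y = Sum.inr 1`,
each adjacent exactly to `v_0, …, v_{k-1}`. -/
def Ygraph (k : ℕ) : SimpleGraph ((Fin k ⊕ Fin 3) ⊕ Fin 2) :=
  SimpleGraph.fromRel fun a b =>
    match a, b with
    | .inl _, .inl _ => True
    | .inr _, .inl (.inl _) => True
    | _, _ => False

namespace SimpleGraph

variable {G : SimpleGraph V} {Z : Set V} {x y z : V}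

lemma dist_eq_two_of_adj_of_adj (hxz : G.Adj x z) (hzy : G.Adj z y)
    (hne : x ≠ y) (hxy : ¬ G.Adj x y) : G.dist x y = 2 := by
  have h2 : G.dist x y ≤ 2 := dist_le (Walk.cons hxz (Walk.cons hzy Walk.nil))
  have h0 : 0 < G.dist x y := (hxz.reachable.trans hzy.reachable).pos_dist_of_ne hne
  have h1 : G.dist x y ≠ 1 := fun h => hxy (dist_eq_one_iff_adj.1 h)
  omega

lemma not_zPositionable_of_adj_of_adj (hxz : G.Adj x z) (hzy : G.Adj z y)
    (hne : x ≠ y) (hxy : ¬ G.Adj x y) (hz : z ∈ Z) : ¬ ZPositionable G Z x y := by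
  intro h
  have hp := h (Walk.cons hxz (Walk.cons hzy Walk.nil))
    (by simp [hxz.ne, hzy.ne, hne])
    (by simp [dist_eq_two_of_adj_of_adj hxz hzy hne hxy]) z hz (by simp)
  exact hp.elim hxz.ne' hzy.ne

lemma zPositionable_of_dist_le_two (hd : G.dist x y ≤ 2)
    (h : ∀ z ∈ Z, G.Adj x z → G.Adj z y → G.dist x y ≠ 2) : ZPositionable G Z x y := by
  intro p _ hlen z hz hzp
  match p with
  | .nil => simp_all
  | .cons _ .nil => simpa using hzp
  | .cons h₁ (.cons h₂ .nil) =>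
    simp only [Walk.support_cons, Walk.support_nil, List.mem_cons, List.not_mem_nil,
      or_false] at hzp
    rcases hzp with rfl | rfl | rfl
    · exact Or.inl rfl
    · exact absurd hlen.symm (h _ hz h₁ h₂)
    · exact Or.inr rfl
  | .cons _ (.cons _ (.cons _ q)) =>
    simp only [Walk.length_cons] at hlen
    omega

lemma zPositionable_self : ZPositionable G Z x x :=
  zPositionable_of_dist_le_two (by simp) (by simp)

lemma zPositionable_of_adj (h : G.Adj x y) : ZPositionable G Z x y := by
  have h1 : G.dist x y = 1 := dist_eq_one_iff_adj.2 h
  exact zPositionable_of_dist_le_two (by omega) (by omega)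

lemma zPositionable_of_isClique {S : Set V} (hS : G.IsClique S) (hx : x ∈ S) (hy : y ∈ S) :
    ZPositionable G Z x y := by
  by_cases h : x = y
  · exact h ▸ zPositionable_self
  · exact zPositionable_of_adj (hS hx hy h)

end SimpleGraph

/-- Two nonadjacent vertices with a common neighbour in a dual general position set are
separated by that set. -/
lemma IsDualGPSet.mem_iff_notMem_s12 {G : SimpleGraph V} {Z : Set V} {x y z : V}
    (h : IsDualGPSet G Z) (hxz : G.Adj x z) (hzy : G.Adj z y)
    (hne : x ≠ y) (hxy : ¬ G.Adj x y) (hz : z ∈ Z) : x ∈ Z ↔ y ∉ Z := by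
  have hnot := not_zPositionable_of_adj_of_adj hxz hzy hne hxy hz
  constructor
  · exact fun hx hy => hnot (h.1 x hx y hy)
  · intro hy
    by_contra hx
    exact hnot (h.2 x hx y hy)

namespace Ygraph

variable {k : ℕ}

/-- The vertices of `Y_k` outside the common neighbourhood `v_0, …, v_{k-1}` of `x` and `y`. -/
def outside (k : ℕ) : Set ((Fin k ⊕ Fin 3) ⊕ Fin 2) := Set.range (Sum.map Sum.inr id)

lemma ncard_outside : (outside k).ncard = 5 := by
  rw [outside, ← Nat.card_coe_set_eq, Nat.card_range_of_injective]
  · simp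
  · exact Sum.map_injective.2 ⟨Sum.inr_injective, Function.injective_id⟩

lemma notMem_outside_iff {a : (Fin k ⊕ Fin 3) ⊕ Fin 2} :
    a ∉ outside k ↔ ∃ i, a = .inl (.inl i) := by
  rcases a with (i | i) | i <;> simp [outside]

@[simp]
lemma adj_inl_inl {a b : Fin k ⊕ Fin 3} : (Ygraph k).Adj (.inl a) (.inl b) ↔ a ≠ b := by
  simp [Ygraph]

@[simp]
lemma adj_inr_inl_inl {a : Fin 2} {i : Fin k} : (Ygraph k).Adj (.inr a) (.inl (.inl i)) := by
  simp [Ygraph]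

@[simp]
lemma not_adj_inr_inl_inr {a : Fin 2} {i : Fin 3} :
    ¬ (Ygraph k).Adj (.inr a) (.inl (.inr i)) := by
  simp [Ygraph]

@[simp]
lemma not_adj_inr_inr {a b : Fin 2} : ¬ (Ygraph k).Adj (.inr a) (.inr b) := by
  simp [Ygraph]

lemma adj_inl_inl_of_ne {i : Fin k} {a : (Fin k ⊕ Fin 3) ⊕ Fin 2} (h : a ≠ .inl (.inl i)) :
    (Ygraph k).Adj a (.inl (.inl i)) := by
  rcases a with a | a
  · simpa using h
  · simp

lemma isDualGPSet_outside (hk : 0 < k) : IsDualGPSet (Ygraph k) (outside k) := by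
  constructor
  · intro a ha b hb
    have hne : ∀ c ∈ outside k, c ≠ .inl (.inl ⟨0, hk⟩) := by
      rintro c hc rfl
      exact notMem_outside_iff.2 ⟨_, rfl⟩ hc
    apply zPositionable_of_dist_le_two
    · exact dist_le (Walk.cons (adj_inl_inl_of_ne (hne a ha))
        (Walk.cons (adj_inl_inl_of_ne (hne b hb)).symm Walk.nil))
    · rintro z hz haz hzb hd
      have hab : a ≠ b := by rintro rfl; simp at hd
      have hnadj : ¬ (Ygraph k).Adj a b := fun h => by
        simp [dist_eq_one_iff_adj.2 h] at hd
      rcases ha with ⟨a | a, rfl⟩ <;> rcases hb with ⟨b | b, rfl⟩ <;>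
        rcases hz with ⟨z | z, rfl⟩ <;>
        simp_all [(Ygraph k).adj_comm (.inl (.inr _)) (.inr _)]
  · intro a ha b hb
    refine zPositionable_of_isClique (S := (outside k)ᶜ) ?_ ha hb
    intro a ha b hb hab
    obtain ⟨i, rfl⟩ := notMem_outside_iff.1 ha
    exact (adj_inl_inl_of_ne hab.symm).symm

lemma subset_outside {Z : Set ((Fin k ⊕ Fin 3) ⊕ Fin 2)} (h : IsDualGPSet (Ygraph k) Z) :
    Z ⊆ outside k := by
  intro z hz
  by_contra hzo
  obtain ⟨i, rfl⟩ := notMem_outside_iff.1 hzo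
  have hxy := h.mem_iff_notMem_s12 (x := .inr 0) (y := .inr 1) (by simp)
    adj_inr_inl_inl.symm (by simp) (by simp) hz
  have hxu := h.mem_iff_notMem_s12 (x := .inr 0) (y := .inl (.inr 0)) (by simp)
    (by simp) (by simp) (by simp) hz
  have hyu := h.mem_iff_notMem_s12 (x := .inr 1) (y := .inl (.inr 0)) (by simp)
    (by simp) (by simp) (by simp) hz
  tauto

lemma gpd_eq_five (hk : 0 < k) : gpd (Ygraph k) = 5 := by
  refine IsGreatest.csSup_eq ⟨⟨_, isDualGPSet_outside hk, ncard_outside⟩, ?_⟩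
  rintro _ ⟨Z, hZ, rfl⟩
  exact ncard_outside (k := k) ▸ Set.ncard_le_ncard (subset_outside hZ)

lemma card_ne_inr_zero :
    Nat.card {y : (Fin k ⊕ Fin 3) ⊕ Fin 2 | y ≠ Sum.inr 0} = k + 4 := by
  rw [Nat.card_coe_set_eq, ← Set.compl_singleton_eq, Set.ncard_compl, Set.ncard_singleton]
  simp

lemma exists_eq_inl_of_ne {a : {y : (Fin k ⊕ Fin 3) ⊕ Fin 2 | y ≠ Sum.inr 0}}
    (h : a ≠ ⟨.inr 1, by simp⟩) : ∃ b, a.1 = .inl b := by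
  obtain ⟨b | b, hb⟩ := a
  · exact ⟨b, rfl⟩
  · have h0 : b ≠ 0 := fun h0 => hb (congrArg Sum.inr h0)
    have h1 : b ≠ 1 := by rintro rfl; exact h rfl
    omega

lemma gpd_induce_ne_inr_zero (hk : 0 < k) :
    gpd ((Ygraph k).induce {y | y ≠ Sum.inr 0}) = k + 3 := by
  refine IsGreatest.csSup_eq ⟨⟨{⟨.inr 1, by simp⟩}ᶜ, ⟨?_, ?_⟩, ?_⟩, ?_⟩
  · intro a ha b hb
    refine zPositionable_of_isClique ?_ ha hb
    intro a ha b hb hab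
    obtain ⟨a', ha'⟩ := exists_eq_inl_of_ne ha
    obtain ⟨b', hb'⟩ := exists_eq_inl_of_ne hb
    have hne : a.1 ≠ b.1 := Subtype.coe_ne_coe.2 hab
    rw [ha', hb'] at hne
    rw [induce_adj, ha', hb', adj_inl_inl]
    exact fun h => hne (congrArg Sum.inl h)
  · intro a ha b hb
    rw [Set.notMem_compl_iff, Set.mem_singleton_iff] at ha hb
    subst ha hb
    exact zPositionable_self
  · rw [Set.ncard_compl, Set.ncard_singleton, card_ne_inr_zero]
    rfl
  · rintro _ ⟨Z, hZ, rfl⟩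
    have hlt : Z.ncard < k + 4 := by
      rw [← card_ne_inr_zero, ← Set.ncard_univ]
      refine Set.ncard_lt_ncard ((Set.ssubset_univ_iff).2 ?_)
      rintro rfl
      have := hZ.mem_iff_notMem_s12 (x := ⟨.inr 1, by simp⟩) (y := ⟨.inl (.inr 0), by simp⟩)
        (z := ⟨.inl (.inl ⟨0, hk⟩), by simp⟩) (by simp) (by simp)
        (Subtype.coe_ne_coe.1 (by simp)) (by simp) trivial
      simp at this
    omega

end Ygraph

/-- For `k ≥ 2`, `gp_d(Y_k) = 5` and `gp_d(Y_k - x) = k + 3`. -/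
theorem Ygraph_gpd (k : ℕ) (hk : 2 ≤ k) :
    gpd (Ygraph k) = 5 ∧
    gpd ((Ygraph k).induce {y | y ≠ Sum.inr 0}) = k + 3 := by
  exact ⟨Ygraph.gpd_eq_five (by omega), Ygraph.gpd_induce_ne_inr_zero (by omega)⟩
end

section
/- Let G be a finite simple connected graph and let e = uv be an edge of G such that G - e is connected. Then gp_t(G) - |S(G)_e| ≤ gp_t(G - e), where S(G)_e denotes the set of simplicial vertices of G that are adjacent to both u and v. -/
open SimpleGraph

variable {V : Type*}

theorem IsSimplicial.deleteEdges_singleton {G : SimpleGraph V} {u v z : V}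
    (hz : IsSimplicial G z) (h : ¬ (G.Adj z u ∧ G.Adj z v)) :
    IsSimplicial (G.deleteEdges {s(u, v)}) z := by
  intro a b ha hb hab
  have ha' := (deleteEdges_adj.mp ha).1
  have hb' := (deleteEdges_adj.mp hb).1
  refine deleteEdges_adj.mpr ⟨hz a b ha' hb' hab, fun heq => h ?_⟩
  rcases Sym2.eq_iff.mp heq with ⟨rfl, rfl⟩ | ⟨rfl, rfl⟩
  · exact ⟨ha', hb'⟩
  · exact ⟨hb', ha'⟩

/-- For an edge `e = uv` of the finite connected graph `G` with
`G - e` connected, `gp_t(G) - |S(G)_e| ≤ gp_t(G - e)`, where `S(G)_e` is the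
set of simplicial vertices of `G` adjacent to both `u` and `v`. -/
theorem gpt_edge_removal_lower [Fintype V] (G : SimpleGraph V) (hG : G.Connected)
    (u v : V) (huv : G.Adj u v) (hconn : (G.deleteEdges {s(u, v)}).Connected) :
    gpt G - {z : V | IsSimplicial G z ∧ G.Adj z u ∧ G.Adj z v}.ncard
      ≤ gpt (G.deleteEdges {s(u, v)}) := by
  obtain ⟨Z, hZ, hcard⟩ := exists_isTotalGPSet_ncard_eq_gpt G
  rw [← hcard]
  refine (Set.le_ncard_sdiff _ Z).trans (IsTotalGPSet.ncard_le_gpt ?_)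
  refine isTotalGPSet_of_forall_isSimplicial fun z hz => ?_
  have hsimp := hZ.isSimplicial hz.1
  exact hsimp.deleteEdges_singleton fun h => hz.2 ⟨hsimp, h⟩
end

section
/- Let G be a finite simple connected graph and let e be an edge of G such that G - e is connected. Then gp_t(G - e) ≤ gp_t(G) + 2. -/
open SimpleGraph

variable {V : Type*}

/-- A simplicial vertex of `G - ab` other than `a` and `b` is simplicial in `G`. -/
theorem IsSimplicial.of_deleteEdges {G : SimpleGraph V} {a b x : V}
    (hx : IsSimplicial (G.deleteEdges {s(a, b)}) x) (hxa : x ≠ a) (hxb : x ≠ b) :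
    IsSimplicial G x := by
  have hadj : ∀ u, G.Adj x u → (G.deleteEdges {s(a, b)}).Adj x u := by
    intro u hu
    simp [deleteEdges_adj, hu, hxa, hxb]
  intro u v hu hv huv
  exact (G.deleteEdges_le _) (hx u v (hadj u hu) (hadj v hv) huv)

/-- For an edge `e` of the finite connected graph `G` with
`G - e` connected, `gp_t(G - e) ≤ gp_t(G) + 2`. -/
theorem gpt_edge_removal_upper [Fintype V] (G : SimpleGraph V) (hG : G.Connected)
    (e : Sym2 V) (he : e ∈ G.edgeSet) (hconn : (G.deleteEdges {e}).Connected) :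
    gpt (G.deleteEdges {e}) ≤ gpt G + 2 := by
  induction e with | _ a b
  refine csSup_le ⟨_, ∅, isTotalGPSet_of_forall_isSimplicial (by simp), rfl⟩ ?_
  rintro _ ⟨Z, hZ, rfl⟩
  have hdiff : IsTotalGPSet G (Z \ {a, b}) := by
    refine isTotalGPSet_of_forall_isSimplicial fun z hz => ?_
    have hzab : z ≠ a ∧ z ≠ b := by simpa using hz.2
    exact (hZ.isSimplicial hz.1).of_deleteEdges hzab.1 hzab.2
  calc Z.ncard ≤ (Z \ {a, b}).ncard + ({a, b} : Set V).ncard :=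
        Set.ncard_le_ncard_sdiff_add_ncard Z {a, b} (Set.toFinite _)
    _ ≤ gpt G + 2 := add_le_add hdiff.ncard_le_gpt ((Set.ncard_insert_le a {b}).trans (by simp))
end

section
/- For every positive integer n there exist a finite simple connected graph G and an edge e of G such that G - e is connected and gp_d(G) - gp_d(G - e) ≥ n. -/
open SimpleGraph

variable {V : Type*}

theorem IsDualGPSet.mem_iff_notMem_of_mem_support {G : SimpleGraph V} {Z : Set V}
    (hZ : IsDualGPSet G Z) {u v w : V} (p : G.Walk u w) (hp : p.length = G.dist u w)
    (hv : v ∈ p.support) (hvZ : v ∈ Z) (hvu : v ≠ u) (hvw : v ≠ w) : u ∈ Z ↔ w ∉ Z := by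
  have hpath := p.isPath_of_length_eq_dist hp
  constructor
  · intro hu hw
    exact (hZ.1 u hu w hw p hpath hp v hvZ hv).elim hvu hvw
  · intro hw
    by_contra hu
    exact (hZ.2 u hu w hw p hpath hp v hvZ hv).elim hvu hvw

theorem SimpleGraph.Walk.two_le_length {G : SimpleGraph V} {u v : V} (p : G.Walk u v)
    (hne : u ≠ v) (hadj : ¬ G.Adj u v) : 2 ≤ p.length :=
  (p.reachable.one_lt_dist_of_ne_of_not_adj hne hadj).trans_le (dist_le p)

theorem SimpleGraph.Walk.three_le_length {G : SimpleGraph V} {u v : V} (p : G.Walk u v)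
    (hne : u ≠ v) (hadj : ¬ G.Adj u v) (hcommon : ∀ w, G.Adj u w → ¬ G.Adj w v) :
    3 ≤ p.length := by
  cases p with
  | nil => exact absurd rfl hne
  | @cons _ w _ h q =>
    have := q.two_le_length (fun e => hadj (e ▸ h)) (hcommon w h)
    simpa using this

/-- A dual general position set avoids every isometric 7-cycle. -/
theorem IsDualGPSet.notMem_of_isometric_seven_cycle {G : SimpleGraph V} {Z : Set V}
    (hZ : IsDualGPSet G Z) (f : Fin 7 → V) (hadj : ∀ i, G.Adj (f i) (f (i + 1)))
    (hne₂ : ∀ i, f i ≠ f (i + 2)) (hadj₂ : ∀ i, ¬ G.Adj (f i) (f (i + 2)))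
    (hne₃ : ∀ i, f i ≠ f (i + 3)) (hadj₃ : ∀ i, ¬ G.Adj (f i) (f (i + 3)))
    (hcommon : ∀ i w, G.Adj (f i) w → ¬ G.Adj w (f (i + 3))) (i : Fin 7) : f i ∉ Z := by
  have h12 (i : Fin 7) : G.Adj (f (i + 1)) (f (i + 2)) := by
    simpa [add_assoc] using hadj (i + 1)
  have h23 (i : Fin 7) : G.Adj (f (i + 2)) (f (i + 3)) := by
    simpa [add_assoc] using hadj (i + 2)
  have two (i : Fin 7) (h : f (i + 1) ∈ Z) : f i ∈ Z ↔ f (i + 2) ∉ Z := by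
    let p : G.Walk (f i) (f (i + 2)) := .cons (hadj i) (.cons (h12 i) .nil)
    obtain ⟨q, hq⟩ := p.reachable.exists_walk_length_eq_dist
    refine hZ.mem_iff_notMem_of_mem_support p (le_antisymm ?_ (dist_le p)) (by simp [p]) h
      (hadj i).ne' (h12 i).ne
    exact hq ▸ q.two_le_length (hne₂ i) (hadj₂ i)
  have three (i : Fin 7) (h : f (i + 1) ∈ Z) : f i ∈ Z ↔ f (i + 3) ∉ Z := by
    let p : G.Walk (f i) (f (i + 3)) := .cons (hadj i) (.cons (h12 i) (.cons (h23 i) .nil))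
    obtain ⟨q, hq⟩ := p.reachable.exists_walk_length_eq_dist
    refine hZ.mem_iff_notMem_of_mem_support p (le_antisymm ?_ (dist_le p)) (by simp [p]) h
      (hadj i).ne' ?_
    · exact hq ▸ q.three_le_length (hne₃ i) (hadj₃ i) (hcommon i)
    · simpa [add_assoc] using hne₂ (i + 1)
  have not_both (i : Fin 7) (h₁ : f (i + 1) ∈ Z) : f (i + 2) ∉ Z := fun h₂ => by
    have h₀ : f i ∉ Z := fun h => (two i h₁).1 h h₂
    have h₃ : f (i + 3) ∉ Z := by
      have := two (i + 1) (by simpa [add_assoc] using h₂)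
      simpa [add_assoc] using this.1 h₁
    exact h₀ ((three i h₁).2 h₃)
  intro hi
  have hpred : f (i - 1) ∉ Z := fun h => not_both (i - 2) (by convert h using 2; grind) (by simpa)
  have hsucc : f (i + 1) ∉ Z := fun h =>
    not_both (i - 1) (by simpa) (by convert h using 2; grind)
  have := two (i - 1) (by simpa)
  rw [show i - 1 + 2 = i + 1 by grind] at this
  exact hpred (this.2 hsucc)

theorem SimpleGraph.Walk.exists_adj_adj_of_mem_support {G : SimpleGraph V} {x y z : V}
    (p : G.Walk x y) (hz : z ∈ p.support) (hzx : z ≠ x) (hzy : z ≠ y) :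
    ∃ u w, G.Adj u z ∧ G.Adj z w ∧ ∃ (q : G.Walk x u) (r : G.Walk w y),
      q.length + r.length + 2 = p.length := by
  obtain ⟨a, b, rfl⟩ := Walk.mem_support_iff_exists_append.1 hz
  cases b with
  | nil => exact absurd rfl hzy
  | @cons _ w _ hw r =>
    cases a with
    | nil => exact absurd rfl hzx
    | @cons _ v _ hv a =>
      obtain ⟨u, q, hu, hq⟩ := Walk.exists_cons_eq_concat hv a
      refine ⟨u, w, hu, hw, q, r, ?_⟩
      rw [hq]
      simp
      omega

/-- The graph obtained from `n` triangles and one 6-cycle by identifying one edge of each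
into the single common edge joining `Sum.inl 0` and `Sum.inl 1`. -/
def triangleHexagonBook (n : ℕ) : SimpleGraph (Fin 6 ⊕ Fin n) where
  Adj
    | .inl i, .inl j => (cycleGraph 6).Adj i j
    | .inl i, .inr _ => i = 0 ∨ i = 1
    | .inr _, .inl i => i = 0 ∨ i = 1
    | .inr _, .inr _ => False
  symm := ⟨by rintro (i | i) (j | j) h <;> first | exact h | exact h.symm⟩
  loopless := ⟨by rintro (i | i) h <;> simp_all⟩

namespace triangleHexagonBook

variable {n : ℕ}

@[simp] theorem adj_inl_inl {i j : Fin 6} :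
    (triangleHexagonBook n).Adj (.inl i) (.inl j) ↔ (cycleGraph 6).Adj i j := .rfl

@[simp] theorem adj_inl_inr {i : Fin 6} {k : Fin n} :
    (triangleHexagonBook n).Adj (.inl i) (.inr k) ↔ i = 0 ∨ i = 1 := .rfl

@[simp] theorem adj_inr_inl {i : Fin 6} {k : Fin n} :
    (triangleHexagonBook n).Adj (.inr k) (.inl i) ↔ i = 0 ∨ i = 1 := .rfl

@[simp] theorem not_adj_inr_inr {k l : Fin n} :
    ¬ (triangleHexagonBook n).Adj (.inr k) (.inr l) := id

/-- The graph obtained by deleting the common edge. -/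
abbrev deleteSpine (n : ℕ) : SimpleGraph (Fin 6 ⊕ Fin n) :=
  (triangleHexagonBook n).deleteEdges {s(.inl 0, .inl 1)}

/-- The 7-cycle of `deleteSpine n` passing through the apex of the `k`-th triangle. -/
def sevenCycle (k : Fin n) : Fin 7 → Fin 6 ⊕ Fin n :=
  ![.inr k, .inl 1, .inl 2, .inl 3, .inl 4, .inl 5, .inl 0]

theorem deleteSpine_adj_sevenCycle (k : Fin n) (i : Fin 7) :
    (deleteSpine n).Adj (sevenCycle k i) (sevenCycle k (i + 1)) := by
  fin_cases i <;>
    simp [sevenCycle] <;> decide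

theorem exists_sevenCycle_eq (hn : 0 < n) (v : Fin 6 ⊕ Fin n) :
    ∃ k i, sevenCycle k i = v := by
  rcases v with i | k
  · refine ⟨⟨0, hn⟩, ?_⟩
    fin_cases i
    exacts [⟨6, rfl⟩, ⟨1, rfl⟩, ⟨2, rfl⟩, ⟨3, rfl⟩, ⟨4, rfl⟩, ⟨5, rfl⟩]
  · exact ⟨k, 0, rfl⟩

theorem deleteSpine_connected (hn : 0 < n) : (deleteSpine n).Connected := by
  have : Nonempty (Fin 6 ⊕ Fin n) := ⟨.inl 1⟩
  have key (v : Fin 6 ⊕ Fin n) : (deleteSpine n).Reachable v (.inl 1) := by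
    obtain ⟨k, i, rfl⟩ := exists_sevenCycle_eq hn v
    have step (i : Fin 7) := (deleteSpine_adj_sevenCycle k i).reachable
    have h0 (i : Fin 7) : (deleteSpine n).Reachable (sevenCycle k 0) (sevenCycle k i) := by
      induction i using Fin.induction with
      | zero => rfl
      | succ i ih => simpa using ih.trans (step i.castSucc)
    exact (h0 i).symm.trans (h0 1)
  exact ⟨fun u v => (key u).trans (key v).symm⟩

theorem eq_empty_of_isDualGPSet_deleteSpine (hn : 0 < n) {Z : Set (Fin 6 ⊕ Fin n)}
    (hZ : IsDualGPSet (deleteSpine n) Z) : Z = ∅ := by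
  refine Set.eq_empty_of_forall_notMem fun v => ?_
  obtain ⟨k, i, rfl⟩ := exists_sevenCycle_eq hn v
  refine hZ.notMem_of_isometric_seven_cycle (sevenCycle k) (deleteSpine_adj_sevenCycle k)
    ?_ ?_ ?_ ?_ ?_ i
  · intro i; fin_cases i <;> simp [sevenCycle]
  · intro i
    fin_cases i <;>
      simp [sevenCycle] <;> decide
  · intro i; fin_cases i <;> simp [sevenCycle]
  · intro i
    fin_cases i <;>
      simp [sevenCycle] <;> decide
  · rintro i (j | j)
    · revert j
      fin_cases i <;>
        simp [sevenCycle] <;> decide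
    · fin_cases i <;>
        simp [sevenCycle]

theorem isDualGPSet_range_inr : IsDualGPSet (triangleHexagonBook n) (Set.range Sum.inr) := by
  constructor
  · rintro _ ⟨i, rfl⟩ _ ⟨j, rfl⟩ p - hp _ ⟨k, rfl⟩ hk
    by_contra! hne
    obtain ⟨u, w, hu, -, q, r, h⟩ := p.exists_adj_adj_of_mem_support hk hne.1 hne.2
    have hi : (triangleHexagonBook n).Adj (.inr i) (.inl 0) := by simp
    have hj : (triangleHexagonBook n).Adj (.inl 0) (.inr j) := by simp
    have hle := dist_le (Walk.cons hi (.cons hj .nil))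
    simp only [Walk.length_cons, Walk.length_nil] at hle
    obtain rfl := q.eq_of_length_eq_zero (by omega)
    exact not_adj_inr_inr hu
  · rintro x hx y hy p - hp _ ⟨k, rfl⟩ hk
    by_contra! hne
    obtain ⟨u, w, hu, hw, q, r, h⟩ := p.exists_adj_adj_of_mem_support hk hne.1 hne.2
    have huw : ∃ s : (triangleHexagonBook n).Walk u w, s.length ≤ 1 := by
      have h01 : (triangleHexagonBook n).Adj (.inl 0) (.inl 1) := by simp; decide
      rcases u with i | i
      · rcases w with j | j
        · obtain rfl | rfl := adj_inl_inr.1 hu <;> obtain rfl | rfl := adj_inr_inl.1 hw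
          exacts [⟨.nil, by simp⟩, ⟨h01.toWalk, by simp⟩, ⟨h01.symm.toWalk, by simp⟩,
            ⟨.nil, by simp⟩]
        · exact (not_adj_inr_inr hw).elim
      · exact (not_adj_inr_inr hu).elim
    obtain ⟨s, hs⟩ := huw
    have hle := dist_le ((q.append s).append r)
    simp only [Walk.length_append] at hle
    omega

end triangleHexagonBook

/-- For every positive integer `n` there exist a finite connected
graph `G` and an edge `e = uv` of `G` such that `G - e` is connected and
`gp_d(G) - gp_d(G - e) ≥ n`. -/
theorem gpd_edge_removal_gap (n : ℕ) (hn : 0 < n) :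
    ∃ (V : Type) (_ : Fintype V) (G : SimpleGraph V) (u v : V),
      G.Adj u v ∧ G.Connected ∧ (G.deleteEdges {s(u, v)}).Connected ∧
      gpd (G.deleteEdges {s(u, v)}) + n ≤ gpd G := by
  refine ⟨Fin 6 ⊕ Fin n, inferInstance, triangleHexagonBook n, .inl 0, .inl 1, ?_,
    (triangleHexagonBook.deleteSpine_connected hn).mono (deleteEdges_le _),
    triangleHexagonBook.deleteSpine_connected hn, ?_⟩
  · rw [triangleHexagonBook.adj_inl_inl]
    decide
  have hle : n ≤ gpd (triangleHexagonBook n) := by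
    refine le_csSup ⟨Nat.card (Fin 6 ⊕ Fin n), ?_⟩
      ⟨_, triangleHexagonBook.isDualGPSet_range_inr, ?_⟩
    · rintro _ ⟨Z, -, rfl⟩
      exact Set.ncard_le_card Z
    · rw [← Set.image_univ, Set.ncard_image_of_injective _ Sum.inr_injective]
      simp
  have hzero : gpd (triangleHexagonBook.deleteSpine n) ≤ 0 := by
    refine csSup_le ⟨0, ∅, by simp [IsDualGPSet, ZPositionable], by simp⟩ ?_
    rintro _ ⟨Z, hZ, rfl⟩
    simp [triangleHexagonBook.eq_empty_of_isDualGPSet_deleteSpine hn hZ]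
  unfold triangleHexagonBook.deleteSpine at hzero
  omega
end
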